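/- arXiv:2210.03064 — 2 statements merged into one kernel-verified Lean document; each statement's English description precedes it below -/
import Mathlib

section
/- For all integers 1 ≤ ℓ < k and every ε ∈ (0, 1/(10·k!)) there exists C = C(ε,k,ℓ) > 0 such that the following holds. Let 𝓗 be a k-uniform hypergraph with |V(𝓗)| ≥ C and let U ⊆ V(𝓗) satisfy |U| = (1 ± ε)·ε²·|V(𝓗)|. Suppose δ_ℓ(𝓗) ≥ (δ⁺_{ℓ,k} + ε/3)·binom(|V(𝓗)|, k−ℓ) and that every ℓ-element set S ⊆ V(𝓗) satisfies deg_𝓗(S, U) ≥ (δ⁺_{ℓ,k} + ε/3)·binom(|U|, k−ℓ). Then there exists a (C/|V(𝓗)|^{k−1})-spread distribution on matchings M ⊆ 𝓗 such that (C1) M covers every vertex of V(𝓗) ∖ U, and (C2) M covers at most ε²·|U| vertices of U. -/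
open Finset

/-- A matching `M` of the hypergraph `H` (on vertex set `Fin n`) which is perfect. -/
def HyperPM {n : ℕ} (H M : Finset (Finset (Fin n))) : Prop :=
  M ⊆ H ∧ (M : Set (Finset (Fin n))).PairwiseDisjoint id ∧ M.biUnion id = Finset.univ

/-- The degree of a vertex set `S` in the hypergraph `H`: the number of hyperedges containing `S`. -/
def hDeg {n : ℕ} (H : Finset (Finset (Fin n))) (S : Finset (Fin n)) : ℕ :=
  (H.filter (fun h => S ⊆ h)).card

/-- `deg_H(S, A)`: the number of hyperedges `h ∈ H` with `S ⊆ h` and `h \ S ⊆ A`. -/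
def hDegOn {n : ℕ} (H : Finset (Finset (Fin n))) (S A : Finset (Fin n)) : ℕ :=
  (H.filter (fun h => S ⊆ h ∧ h \ S ⊆ A)).card

/-- `t(n,k,ℓ)`: the smallest `d` such that every `n`-vertex `k`-uniform hypergraph with
minimum `ℓ`-degree at least `d` contains a perfect matching. -/
noncomputable def diracT (n k l : ℕ) : ℕ :=
  sInf {d : ℕ | ∀ H : Finset (Finset (Fin n)), (∀ e ∈ H, e.card = k) →
    (∀ S : Finset (Fin n), S.card = l → d ≤ hDeg H S) → ∃ M, HyperPM H M}

/-- The `ℓ`-degree Dirac threshold `δ⁺_{ℓ,k} = lim_{n → ∞, k ∣ n} t(n,k,ℓ)/C(n,k-ℓ)`. -/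
noncomputable def diracThreshold (k l : ℕ) : ℝ :=
  Filter.limsup (fun n : ℕ => (diracT n k l : ℝ) / (n.choose (k - l)))
    (Filter.atTop ⊓ Filter.principal {n | k ∣ n})

/-- `μ` is a `q`-spread probability distribution on the collection of finite subsets (of the
ground set of elements of type `α`) satisfying `Fam`. -/
def IsSpreadDist {α : Type*} [Fintype α] [DecidableEq α] (q : ℝ)
    (Fam : Finset α → Prop) (μ : Finset α → ℝ) : Prop :=
  (∀ A, 0 ≤ μ A) ∧ (∑ A : Finset α, μ A = 1) ∧ (∀ A, μ A ≠ 0 → Fam A) ∧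
    ∀ S : Finset α, ∑ A ∈ Finset.univ.filter (fun A : Finset α => S ⊆ A), μ A ≤ q ^ S.card

theorem card_equiv_extending_mul_le {α β γ : Type*} [Fintype α] [Fintype β] [Fintype γ]
    [DecidableEq α] [DecidableEq β] (g : γ → α) (hg : Function.Injective g)
    (f : γ → β) :
    #{τ : α ≃ β | ∀ c, τ (g c) = f c} * (Fintype.card β).descFactorial (Fintype.card γ)
      ≤ Fintype.card (α ≃ β) := by
  classical
  by_cases hf : Function.Injective f
  · have key : ∀ f' : γ ↪ β, ∃ π : Equiv.Perm β, ∀ c, π (f c) = f' c := by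
      intro f'
      let e := (Equiv.ofInjective f hf).symm.trans (Equiv.ofInjective f' f'.injective)
      refine ⟨e.extendSubtype, fun c => ?_⟩
      rw [Equiv.extendSubtype_apply_of_mem e (f c) ⟨c, rfl⟩]
      have : (⟨f c, ⟨c, rfl⟩⟩ : {x // x ∈ Set.range f}) = Equiv.ofInjective f hf c := rfl
      simp only [e, this, Equiv.trans_apply, Equiv.symm_apply_apply]
      rfl
    choose π hπ using key
    rw [← Fintype.card_embedding_eq, ← Finset.card_univ (α := γ ↪ β), ← Finset.card_product,
      ← Finset.card_univ]
    refine Finset.card_le_card_of_injOn (fun x => x.1.trans (π x.2)) (by simp) ?_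
    rintro ⟨τ, f₁⟩ h₁ ⟨τ', f₂⟩ h₂ h
    simp only [coe_product, coe_filter, mem_univ, true_and, coe_univ, Set.mem_prod,
      Set.mem_ofPred_eq, Set.mem_univ, and_true] at h₁ h₂
    have hff : f₁ = f₂ := by
      ext c
      have := congrArg (fun e : α ≃ β => e (g c)) h
      simpa [h₁, h₂, hπ] using this
    subst hff
    simp only [Prod.mk.injEq, and_true]
    ext a
    have := congrArg (fun e : α ≃ β => e a) h
    simpa using this
  · have : ({τ : α ≃ β | ∀ c, τ (g c) = f c} : Finset (α ≃ β)) = ∅ := by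
      refine Finset.filter_eq_empty_iff.2 fun τ _ h => hf fun a b hab => ?_
      exact hg (τ.injective (by rw [h, h, hab]))
    simp [this]

theorem sum_perm_eq {R : Type*} [Fintype R] [DecidableEq R] (F : Finset R → ℝ) (B : Finset R) :
    ((Fintype.card R).choose #B : ℝ) * ∑ π : Equiv.Perm R, F (B.map π.toEmbedding) =
      (Fintype.card R).factorial * ∑ J ∈ powersetCard #B univ, F J := by
  have h1 : ∀ J ∈ powersetCard #B (univ : Finset R),
      ∑ π : Equiv.Perm R, F (J.map π.toEmbedding) = ∑ π : Equiv.Perm R, F (B.map π.toEmbedding) := by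
    intro J hJ
    have hc : Fintype.card {x // x ∈ B} = Fintype.card {x // x ∈ J} := by
      simp [(mem_powersetCard.1 hJ).2]
    let e := (Fintype.equivOfCardEq hc)
    have hJB : J = B.map (e.extendSubtype : Equiv.Perm R).toEmbedding := by
      symm
      refine Finset.eq_of_subset_of_card_le ?_ (by simp [(mem_powersetCard.1 hJ).2])
      intro x hx
      obtain ⟨y, hy, rfl⟩ := Finset.mem_map.1 hx
      exact e.extendSubtype_mem y hy
    refine Fintype.sum_equiv (Equiv.mulRight e.extendSubtype) _ _ fun π => ?_
    have := congrArg (fun J' => F (J'.map π.toEmbedding)) hJB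
    simp only [Finset.map_map] at this
    exact this
  have h2 : ∀ π : Equiv.Perm R, ∑ J ∈ powersetCard #B univ, F (J.map π.toEmbedding) =
      ∑ J ∈ powersetCard #B univ, F J := by
    intro π
    refine Finset.sum_equiv (π.finsetCongr) ?_ ?_
    · simp [mem_powersetCard]
    · simp
  calc _ = ∑ J ∈ powersetCard #B univ, ∑ π : Equiv.Perm R, F (J.map π.toEmbedding) := by
        rw [Finset.sum_congr rfl h1]; simp
    _ = _ := by
        rw [Finset.sum_comm, Finset.sum_congr rfl fun π _ => h2 π]
        simp [Fintype.card_perm]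

theorem exp_neg_le_quadratic {x : ℝ} (hx : 0 ≤ x) : Real.exp (-x) ≤ 1 - x + x ^ 2 / 2 := by
  have h := Real.quadratic_le_exp_of_nonneg hx
  rw [Real.exp_neg, inv_le_iff_one_le_mul₀ (Real.exp_pos x)]
  nlinarith [sq_nonneg (x ^ 2), sq_nonneg (x - 1)]

theorem card_few_le {R β : Type*} [Fintype R] [DecidableEq R] [Fintype β] [DecidableEq β]
    [Nonempty β] (G : Finset β → Prop) [DecidablePred G] {q r : ℕ} (e : R ≃ Fin q × Fin r)
    {p η : ℝ} (hη : 0 ≤ η)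
    (hp : p * (Fintype.card β : ℝ) ^ r ≤ #{y : Fin r → β | G (univ.image y)}) :
    (#{x : R → β | (#{J ∈ powersetCard r (univ : Finset R) | G (J.image x)} : ℝ) <
      (p - η) * (q * r).choose r} : ℝ) ≤
      Real.exp (-(q * η ^ 2 / 2)) * (Fintype.card β : ℝ) ^ (q * r) := by
  set N : ℝ := (Fintype.card β : ℝ) with hN
  have hN0 : 0 < N := by simp [hN, Fintype.card_pos]
  set X : Finset R → (R → β) → ℝ := fun J x => if G (J.image x) then 1 else 0 with hX
  let B : Fin q → Finset R := fun i => univ.map ⟨fun j => e.symm (i, j), fun a b h => by simpa using h⟩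
  have hB : ∀ i, #(B i) = r := fun i => by simp [B]
  have hR : Fintype.card R = q * r := by simp [Fintype.card_congr e]
  set a : ℝ := Real.exp (-η)
  have ha1 : a ≤ 1 := Real.exp_le_one_iff.2 (by linarith)
  have hp1 : p ≤ 1 := by
    have h1 : (#{y : Fin r → β | G (univ.image y)} : ℝ) ≤ N ^ r := by
      have : #{y : Fin r → β | G (univ.image y)} ≤ Fintype.card (Fin r → β) := card_le_univ _
      rw [hN]; simp only [Fintype.card_pi, prod_const, card_univ, Fintype.card_fin] at this
      exact_mod_cast this
    have h2 : 0 < N ^ r := by positivity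
    nlinarith
  have hmgf0 : ∑ x : R → β, Real.exp (-(η * ∑ i, X (B i) x)) ≤ (N ^ r * (1 - p * (1 - a))) ^ q := by
    have h1 : ∑ x : R → β, Real.exp (-(η * ∑ i, X (B i) x)) =
        ∑ y : Fin q → Fin r → β, ∏ i, Real.exp (-(η * if G (univ.image (y i)) then 1 else 0)) := by
      refine Fintype.sum_equiv ((e.arrowCongr (Equiv.refl β)).trans (Equiv.curry _ _ _)) _ _ fun x => ?_
      rw [← Real.exp_sum, Finset.mul_sum, ← Finset.sum_neg_distrib]
      congr 1
      refine Finset.sum_congr rfl fun i _ => ?_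
      simp only [hX, B, Finset.map_eq_image, Finset.image_image]
      rfl
    rw [h1, ← Fintype.sum_pow (fun y : Fin r → β =>
      Real.exp (-(η * if G (univ.image y) then 1 else 0)))]
    have h2 : ∀ y : Fin r → β, Real.exp (-(η * if G (univ.image y) then 1 else 0)) =
        1 - (1 - a) * if G (univ.image y) then 1 else 0 := by
      intro y
      split_ifs <;> simp [a]
    refine pow_le_pow_left₀ (Finset.sum_nonneg fun _ _ => (Real.exp_pos _).le) ?_ q
    simp only [h2, Finset.sum_sub_distrib, ← Finset.mul_sum, Finset.sum_boole]
    simp only [sum_const, card_univ, Fintype.card_pi, prod_const, Fintype.card_fin, nsmul_eq_mul,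
      mul_one, Nat.cast_pow]
    nlinarith
  have hmgf : ∀ π : Equiv.Perm R, ∑ x : R → β, Real.exp (-(η * ∑ i, X ((B i).map π.toEmbedding) x))
      ≤ (N ^ r * (1 - p * (1 - a))) ^ q := by
    intro π
    refine le_of_eq_of_le ?_ hmgf0
    refine Fintype.sum_equiv (π.symm.arrowCongr (Equiv.refl β)) _ _ fun x => ?_
    simp only [hX, Finset.map_eq_image, Finset.image_image]
    rfl
  set D : (R → β) → ℝ := fun x =>
    (#{J ∈ powersetCard r (univ : Finset R) | G (J.image x)} : ℝ) with hD
  set Cq : ℝ := ((q * r).choose r : ℝ) with hCq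
  have hq : ∀ i : Fin q, 0 < Cq := by
    intro i
    have : r ≤ q * r := Nat.le_mul_of_pos_left _ i.pos
    simpa [hCq] using Nat.choose_pos this
  set f : ℝ := ((Fintype.card R).factorial : ℝ) with hf
  have hf0 : 0 < f := by simp [hf, Nat.factorial_pos]
  have hsum : ∀ x, Cq * ∑ π : Equiv.Perm R, ∑ i, X ((B i).map π.toEmbedding) x = f * (q * D x) := by
    intro x
    rw [Finset.sum_comm, Finset.mul_sum]
    have : ∀ i : Fin q, Cq * ∑ π : Equiv.Perm R, X ((B i).map π.toEmbedding) x = f * D x := by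
      intro i
      have := sum_perm_eq (fun J => X J x) (B i)
      rw [hB, hR] at this
      rw [hCq, this, hf, hR]
      simp [hX, hD]
    rw [Finset.sum_congr rfl fun i _ => this i]
    simp; ring
  have hjensen : ∀ x, D x < (p - η) * Cq → Real.exp (-(η * (q * (p - η)))) ≤
      f⁻¹ * ∑ π : Equiv.Perm R, Real.exp (-(η * ∑ i, X ((B i).map π.toEmbedding) x)) := by
    intro x hx
    have hj := convexOn_exp.map_sum_le (t := (univ : Finset (Equiv.Perm R))) (w := fun _ => f⁻¹)
      (p := fun π => -(η * ∑ i, X ((B i).map π.toEmbedding) x)) (by intros; positivity)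
      (by simp [Fintype.card_perm, hf, Nat.factorial_ne_zero]) (by simp)
    simp only [smul_eq_mul, ← Finset.mul_sum, Finset.sum_neg_distrib] at hj
    refine le_trans (Real.exp_le_exp.2 ?_) hj
    rw [mul_neg, neg_le_neg_iff]
    set T := ∑ π : Equiv.Perm R, ∑ i, X ((B i).map π.toEmbedding) x with hT
    have h3 := hsum x
    rcases Nat.eq_zero_or_pos q with h0 | h0
    · subst h0
      simp [hT]
    · have hC := hq ⟨0, h0⟩
      have h4 : f⁻¹ * T = q * D x / Cq := by
        field_simp
        linarith
      have h5 : f⁻¹ * (η * T) = η * (q * (D x / Cq)) := by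
        rw [mul_left_comm, h4]; ring
      rw [h5]
      have h6 : D x / Cq ≤ p - η := by rw [div_le_iff₀ hC]; exact hx.le
      gcongr
  have hmarkov : (#{x : R → β | D x < (p - η) * Cq} : ℝ) * Real.exp (-(η * (q * (p - η)))) ≤
      (N ^ r * (1 - p * (1 - a))) ^ q := by
    calc _ = ∑ x : R → β with D x < (p - η) * Cq, Real.exp (-(η * (q * (p - η)))) := by simp
      _ ≤ ∑ x : R → β with D x < (p - η) * Cq, f⁻¹ * ∑ π : Equiv.Perm R,
            Real.exp (-(η * ∑ i, X ((B i).map π.toEmbedding) x)) :=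
          Finset.sum_le_sum fun x hx => hjensen x (by simpa using hx)
      _ ≤ ∑ x : R → β, f⁻¹ * ∑ π : Equiv.Perm R,
            Real.exp (-(η * ∑ i, X ((B i).map π.toEmbedding) x)) :=
          Finset.sum_le_sum_of_subset_of_nonneg (by simp) fun x _ _ => by positivity
      _ = f⁻¹ * ∑ π : Equiv.Perm R, ∑ x : R → β,
            Real.exp (-(η * ∑ i, X ((B i).map π.toEmbedding) x)) := by
          rw [← Finset.mul_sum, Finset.sum_comm]
      _ ≤ f⁻¹ * ∑ π : Equiv.Perm R, (N ^ r * (1 - p * (1 - a))) ^ q := by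
          gcongr with π
          exact hmgf π
      _ = _ := by
          have : f⁻¹ * f = 1 := inv_mul_cancel₀ hf0.ne'
          simp only [sum_const, card_univ, Fintype.card_perm, nsmul_eq_mul]
          rw [← mul_assoc, ← hf, this, one_mul]
  have hbase : (1 - p * (1 - a)) ^ q ≤ Real.exp (-(q * (p * (1 - a)))) := by
    have h1 : 0 ≤ 1 - p * (1 - a) := by
      have : 0 ≤ a := (Real.exp_pos _).le
      nlinarith
    have h2 := pow_le_pow_left₀ h1 (Real.one_sub_le_exp_neg (p * (1 - a))) q
    rw [← Real.exp_nat_mul] at h2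
    simpa using h2
  have ha2 : a ≤ 1 - η + η ^ 2 / 2 := exp_neg_le_quadratic hη
  by_cases hp0 : p < 0
  · have : ({x : R → β | D x < (p - η) * Cq} : Finset _) = ∅ := by
      refine Finset.filter_eq_empty_iff.2 fun x _ => not_lt.2 ?_
      have h1 : 0 ≤ D x := by simp [hD]
      have h2 : 0 ≤ Cq := by simp [hCq]
      nlinarith
    rw [this]
    simp only [card_empty, Nat.cast_zero]
    positivity
  push Not at hp0
  calc _ = (#{x : R → β | D x < (p - η) * Cq} : ℝ) * Real.exp (-(η * (q * (p - η)))) *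
          Real.exp (η * (q * (p - η))) := by
        rw [mul_assoc, ← Real.exp_add]; simp [hD]
    _ ≤ (N ^ r * (1 - p * (1 - a))) ^ q * Real.exp (η * (q * (p - η))) := by gcongr
    _ ≤ N ^ (q * r) * (Real.exp (-(q * (p * (1 - a)))) * Real.exp (η * (q * (p - η)))) := by
        rw [mul_pow, ← pow_mul, mul_comm r q, mul_assoc]
        gcongr
    _ ≤ N ^ (q * r) * Real.exp (-(q * η ^ 2 / 2)) := by
        rw [← Real.exp_add]
        gcongr
        have h1 : p * (η - η ^ 2 / 2) ≤ p * (1 - a) :=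
          mul_le_mul_of_nonneg_left (by linarith) hp0
        have h2 : p * η ^ 2 ≤ 1 * η ^ 2 := by gcongr
        have h3 : -(p * (1 - a)) + η * (p - η) ≤ -(η ^ 2 / 2) := by nlinarith
        have h4 := mul_le_mul_of_nonneg_left h3 (Nat.cast_nonneg (α := ℝ) q)
        linarith
    _ = _ := mul_comm _ _

theorem diracT_le {n k l : ℕ} (hln : l ≤ n) : diracT n k l ≤ n.choose (k - l) + 1 := by
  refine Nat.sInf_le fun H hH hd => ?_
  obtain ⟨S, -, hS⟩ := Finset.exists_subset_card_eq (s := (univ : Finset (Fin n))) (n := l) (by simpa)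
  have h1 := hd S hS
  have h2 : hDeg H S ≤ #(powersetCard (k - l) (univ : Finset (Fin n))) := by
    refine Finset.card_le_card_of_injOn (fun e => e \ S) ?_ ?_
    · intro e he
      simp only [coe_filter, Set.mem_ofPred_eq] at he
      simp [mem_powersetCard, Finset.card_sdiff_of_subset he.2, hH e he.1, hS]
    · intro e he e' he' h
      simp only [coe_filter, Set.mem_ofPred_eq] at he he' h
      rw [← Finset.sdiff_union_of_subset he.2, h, Finset.sdiff_union_of_subset he'.2]
  simp only [card_powersetCard, card_univ, Fintype.card_fin] at h2
  omega

theorem exists_hyperPM_of_diracT_le {n k l : ℕ} {H : Finset (Finset (Fin n))}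
    (hH : ∀ e ∈ H, #e = k) (hln : l ≤ n) (hd : ∀ S : Finset (Fin n), #S = l → diracT n k l ≤ hDeg H S) :
    ∃ M, HyperPM H M := by
  have hne : {d : ℕ | ∀ H : Finset (Finset (Fin n)), (∀ e ∈ H, e.card = k) →
    (∀ S : Finset (Fin n), S.card = l → d ≤ hDeg H S) → ∃ M, HyperPM H M}.Nonempty := by
    refine ⟨Fintype.card (Finset (Fin n)) + 1, fun H _ hd => ?_⟩
    obtain ⟨S, -, hS⟩ :=
      Finset.exists_subset_card_eq (s := (univ : Finset (Fin n))) (n := l) (by simpa)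
    have h1 := hd S hS
    have h2 : hDeg H S ≤ _ := card_le_univ _
    omega
  exact Nat.sInf_mem hne H hH hd

/-- The `k`-uniform hypergraph on `Fin m` whose edges are mapped into `H` by `x`. -/
def pullbackHypergraph {β : Type*} [DecidableEq β] (H : Finset (Finset β)) (k : ℕ) {m : ℕ}
    (x : Fin m → β) : Finset (Finset (Fin m)) :=
  {e ∈ powersetCard k univ | e.image x ∈ H}

open Classical in
theorem card_not_hyperPM_le {β : Type*} [Fintype β] [DecidableEq β] [Nonempty β]
    (H : Finset (Finset β)) {k l m q r : ℕ} (hk : k = l + r) (hm : m = l + q * r) {p η : ℝ}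
    (hη : 0 ≤ η)
    (hp : ∀ S : Finset β, #S = l →
      p * (Fintype.card β : ℝ) ^ r ≤ #{y : Fin r → β | S ∪ univ.image y ∈ H})
    (hD : (diracT m k l : ℝ) ≤ (p - η) * (q * r).choose r) :
    (#{x : Fin m → β | Function.Injective x ∧ ¬ ∃ M, HyperPM (pullbackHypergraph H k x) M} : ℝ) ≤
      m.choose l * Real.exp (-(q * η ^ 2 / 2)) * (Fintype.card β : ℝ) ^ m := by
  set bad : Finset (Fin m) → Finset (Fin m → β) := fun I =>
    {x | #(I.image x) = l ∧
      (#{J ∈ powersetCard r (univ : Finset {i // i ∉ I}) |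
        I.image x ∪ J.image (fun i : {i // i ∉ I} => x i) ∈ H} : ℝ) < (p - η) * (q * r).choose r} with hbad
  have hsub : ({x : Fin m → β | Function.Injective x ∧
      ¬ ∃ M, HyperPM (pullbackHypergraph H k x) M} : Finset _) ⊆
      (powersetCard l univ).biUnion bad := by
    intro x hx
    simp only [mem_filter, mem_univ, true_and] at hx
    obtain ⟨hinj, hx⟩ := hx
    have : ¬ ∀ S : Finset (Fin m), #S = l → diracT m k l ≤ hDeg (pullbackHypergraph H k x) S :=
      fun h => hx (exists_hyperPM_of_diracT_le
        (fun e he => by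
          simp only [pullbackHypergraph, mem_filter, mem_powersetCard] at he; exact he.1.2)
        (by omega) h)
    push Not at this
    obtain ⟨I, hI, hlt⟩ := this
    refine mem_biUnion.2 ⟨I, by simp [mem_powersetCard, hI], ?_⟩
    simp only [hbad, mem_filter, mem_univ, true_and]
    refine ⟨by rw [card_image_of_injective _ hinj, hI], lt_of_lt_of_le ?_ hD⟩
    rw [Nat.cast_lt]
    refine lt_of_le_of_lt ?_ hlt
    have hdisj : ∀ J : Finset {i // i ∉ I}, Disjoint I (J.map (Function.Embedding.subtype _)) := by
      intro J
      rw [Finset.disjoint_right]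
      intro i hi
      obtain ⟨a, -, rfl⟩ := Finset.mem_map.1 hi
      exact a.2
    refine Finset.card_le_card_of_injOn
      (fun J => I ∪ J.map (Function.Embedding.subtype _)) ?_ ?_
    · intro J hJ
      simp only [coe_filter, Set.mem_ofPred_eq, mem_powersetCard] at hJ
      simp only [pullbackHypergraph, coe_filter, Set.mem_ofPred_eq, mem_filter, mem_powersetCard,
        subset_univ, true_and, subset_union_left, and_true]
      refine ⟨by rw [card_union_of_disjoint (hdisj J), card_map, hI, hJ.1.2, hk], ?_⟩
      rw [image_union, map_eq_image, image_image]
      exact hJ.2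
    · intro J _ J' _ h
      have h' := congrArg (fun A => A \ I) h
      simp only [union_sdiff_left, (hdisj _).symm.sdiff_eq_left] at h'
      exact Finset.map_injective _ h'
  have hcard : ∀ I ∈ powersetCard l (univ : Finset (Fin m)), (#(bad I) : ℝ) ≤
      Real.exp (-(q * η ^ 2 / 2)) * (Fintype.card β : ℝ) ^ m := by
    intro I hI
    have hI := (mem_powersetCard.1 hI).2
    have hR : Fintype.card {i // i ∉ I} = Fintype.card (Fin q × Fin r) := by
      rw [Fintype.card_subtype_compl]; simp [hI, hm]
    let e := Fintype.equivOfCardEq hR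
    have hfib : ∀ a : {i // i ∈ I} → β,
        (#{x ∈ bad I | (fun i : {i // i ∈ I} => x i) = a} : ℝ) ≤
        Real.exp (-(q * η ^ 2 / 2)) * (Fintype.card β : ℝ) ^ (q * r) := by
      intro a
      by_cases ha : #(univ.image a) = l
      · refine le_trans ?_ (card_few_le (fun T => univ.image a ∪ T ∈ H) e hη (hp _ ha))
        rw [Nat.cast_le]
        have him : ∀ x : Fin m → β, (fun i : {i // i ∈ I} => x i) = a → I.image x = univ.image a := by
          rintro x rfl
          ext; simp
        refine Finset.card_le_card_of_injOn (fun x (i : {i // i ∉ I}) => x i) ?_ ?_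
        · intro x hx
          simp only [hbad, coe_filter, Set.mem_ofPred_eq, mem_filter, mem_univ, true_and] at hx ⊢
          rw [← him x hx.2]
          exact hx.1.2
        · intro x hx x' hx' h
          simp only [coe_filter, Set.mem_ofPred_eq] at hx hx' h
          ext1 i
          by_cases hi : i ∈ I
          · exact congrFun (hx.2.trans hx'.2.symm) ⟨i, hi⟩
          · exact congrFun h ⟨i, hi⟩
      · have : ({x ∈ bad I | (fun i : {i // i ∈ I} => x i) = a} : Finset _) = ∅ := by
          refine Finset.filter_eq_empty_iff.2 ?_
          rintro x hx rfl
          simp only [hbad, mem_filter, mem_univ, true_and] at hx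
          apply ha
          rw [← hx.1]
          congr 1
          ext; simp
        rw [this]
        simp only [card_empty, Nat.cast_zero]
        positivity
    rw [card_eq_sum_card_fiberwise (f := fun x (i : {i // i ∈ I}) => x i) (t := univ) (by simp)]
    rw [Nat.cast_sum]
    refine (Finset.sum_le_sum fun a _ => hfib a).trans ?_
    simp only [sum_const, card_univ, Fintype.card_pi, prod_const, Fintype.card_coe, hI,
      nsmul_eq_mul, Nat.cast_pow]
    rw [hm, pow_add]
    linarith
  calc _ ≤ (#((powersetCard l univ).biUnion bad) : ℝ) := by exact_mod_cast card_le_card hsub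
    _ ≤ ∑ I ∈ powersetCard l (univ : Finset (Fin m)), (#(bad I) : ℝ) := by
        exact_mod_cast card_biUnion_le
    _ ≤ ∑ I ∈ powersetCard l (univ : Finset (Fin m)),
        Real.exp (-(q * η ^ 2 / 2)) * (Fintype.card β : ℝ) ^ m := Finset.sum_le_sum hcard
    _ = _ := by simp [mul_assoc]

theorem pow_le_exp_mul_descFactorial {N t : ℕ} (h : t ≤ N) :
    (N : ℝ) ^ t ≤ Real.exp t * N.descFactorial t := by
  rcases Nat.eq_zero_or_pos t with rfl | ht
  · simp
  have h1 : N ^ t * t.factorial ≤ t ^ t * N.descFactorial t := by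
    have e1 : ∀ a : ℕ, a ^ t = ∏ _i ∈ range t, a := by simp
    rw [← Nat.descFactorial_self, Nat.descFactorial_eq_prod_range, Nat.descFactorial_eq_prod_range,
      e1, e1, ← Finset.prod_mul_distrib, ← Finset.prod_mul_distrib]
    refine Finset.prod_le_prod' fun i hi => ?_
    have hi := Finset.mem_range.1 hi
    obtain ⟨a, rfl⟩ := Nat.exists_eq_add_of_lt hi
    obtain ⟨b, rfl⟩ := Nat.exists_eq_add_of_le h
    have e1 : i + a + 1 - i = a + 1 := by omega
    have e2 : i + a + 1 + b - i = a + 1 + b := by omega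
    rw [e1, e2]
    nlinarith
  have h2 := Real.pow_div_factorial_le_exp (t : ℝ) (by positivity) t
  rw [div_le_iff₀ (by positivity)] at h2
  have h3 : (N : ℝ) ^ t * t.factorial ≤ t ^ t * N.descFactorial t := by exact_mod_cast h1
  have h4 : (0 : ℝ) < t.factorial := by positivity
  refine le_of_mul_le_mul_right ?_ h4
  calc _ ≤ (t : ℝ) ^ t * N.descFactorial t := h3
    _ ≤ (Real.exp t * t.factorial) * N.descFactorial t := by gcongr
    _ = _ := by ring

theorem card_monochromatic_le {β : Type*} [Fintype β] [DecidableEq β] {k b m N : ℕ}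
    (hN : Fintype.card β = N) (hm : 0 < m) (S : Finset (Finset β))
    (hS : (S : Set (Finset β)).PairwiseDisjoint id) (hk : ∀ e ∈ S, #e = k) :
    (#{τ : β ≃ Fin N | ∀ e ∈ S, ∃ j < b, ∀ v ∈ e, (τ v : ℕ) / m = j} : ℝ) ≤
      (b * m ^ k * (Real.exp 1 / N) ^ k) ^ #S * Fintype.card (β ≃ Fin N) := by
  classical
  set T := S.biUnion id with hT
  have hTc : #T = k * #S := by
    rw [hT, card_biUnion hS, sum_congr rfl (g := fun _ => k) (by simpa using hk)]
    simp [mul_comm]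
  have hTN : #T ≤ N := hN ▸ card_le_univ T
  have hE : ∀ v : T, ∃ e : S, (v : β) ∈ (e : Finset β) := by
    rintro ⟨v, hv⟩
    obtain ⟨e, he, hve⟩ := mem_biUnion.1 hv
    exact ⟨⟨e, he⟩, hve⟩
  choose E hE using hE
  let P : (S → Fin b) → Finset (T → Fin N) := fun J =>
    Fintype.piFinset fun v => {i : Fin N | (i : ℕ) / m = J (E v)}
  have hP : ∀ J, #(P J) ≤ m ^ #T := by
    intro J
    rw [Fintype.card_piFinset, ← Fintype.card_coe T, ← Finset.card_univ, ← Finset.prod_const]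
    refine Finset.prod_le_prod' fun v _ => ?_
    calc _ = #(({i : Fin N | (i : ℕ) / m = J (E v)} : Finset (Fin N)).map Fin.valEmbedding) :=
          (card_map _).symm
      _ ≤ #(Finset.Ico (m * (J (E v) : ℕ)) (m * (J (E v) : ℕ) + m)) := by
          refine card_le_card fun x hx => ?_
          obtain ⟨i, hi, rfl⟩ := Finset.mem_map.1 hx
          simp only [mem_filter, mem_univ, true_and] at hi
          rw [Finset.mem_Ico, ← hi, Fin.valEmbedding_apply]
          have h1 := Nat.div_add_mod (i : ℕ) m
          have h2 := Nat.mod_lt (i : ℕ) hm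
          omega
      _ = m := by simp
  have hsub : ({τ : β ≃ Fin N | ∀ e ∈ S, ∃ j < b, ∀ v ∈ e, (τ v : ℕ) / m = j} : Finset _) ⊆
      (univ : Finset (S → Fin b)).biUnion fun J => (P J).biUnion fun f =>
        {τ : β ≃ Fin N | ∀ v : T, τ v = f v} := by
    intro τ hτ
    simp only [mem_filter, mem_univ, true_and] at hτ
    choose! j hj hj' using hτ
    simp only [mem_biUnion, mem_univ, true_and, mem_filter]
    refine ⟨fun e => ⟨j e, hj _ e.2⟩, fun v => τ v, ?_, fun v => rfl⟩
    simp only [P, Fintype.mem_piFinset, mem_filter, mem_univ, true_and]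
    exact fun v => hj' _ (E v).2 _ (hE v)
  have hcard : #{τ : β ≃ Fin N | ∀ e ∈ S, ∃ j < b, ∀ v ∈ e, (τ v : ℕ) / m = j} *
      N.descFactorial #T ≤ b ^ #S * m ^ #T * Fintype.card (β ≃ Fin N) := by
    calc _ ≤ (∑ J : S → Fin b, ∑ f ∈ P J, #{τ : β ≃ Fin N | ∀ v : T, τ v = f v}) *
          N.descFactorial #T := by
          gcongr
          refine (card_le_card hsub).trans (card_biUnion_le.trans ?_)
          exact Finset.sum_le_sum fun J _ => card_biUnion_le
      _ = ∑ J : S → Fin b, ∑ f ∈ P J, #{τ : β ≃ Fin N | ∀ v : T, τ v = f v} *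
          N.descFactorial #T := by
          simp only [Finset.sum_mul]
      _ ≤ ∑ J : S → Fin b, ∑ f ∈ P J, Fintype.card (β ≃ Fin N) := by
          gcongr with J _ f _
          simpa using card_equiv_extending_mul_le (fun v : T => (v : β)) Subtype.val_injective f
      _ = (∑ J : S → Fin b, #(P J)) * Fintype.card (β ≃ Fin N) := by
          simp [Finset.sum_mul]
      _ ≤ (∑ J : S → Fin b, m ^ #T) * Fintype.card (β ≃ Fin N) := by
          gcongr with J
          exact hP J
      _ = _ := by simp
  have hexp := pow_le_exp_mul_descFactorial hTN
  rcases Nat.eq_zero_or_pos N with h0 | hN0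
  · have : #T = 0 := by omega
    rw [this] at hcard
    have h0' := hTc.symm.trans this
    rcases Nat.mul_eq_zero.1 h0' with rfl | h0'
    · have h1 : (#{τ : β ≃ Fin N | ∀ e ∈ S, ∃ j < b, ∀ v ∈ e, (τ v : ℕ) / m = j} : ℝ)  ≤
        b ^ #S * Fintype.card (β ≃ Fin N) := by exact_mod_cast (by simpa using hcard)
      simpa using h1
    · rw [h0'] at hcard ⊢
      have h1 : (#{τ : β ≃ Fin N | ∀ e ∈ S, ∃ j < b, ∀ v ∈ e, (τ v : ℕ) / m = j} : ℝ)  ≤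
        Fintype.card (β ≃ Fin N) := by exact_mod_cast (by simpa using hcard)
      simpa using h1
  have hN0' : (0 : ℝ) < N := by exact_mod_cast hN0
  have hd : (0 : ℝ) < N.descFactorial #T := by
    exact_mod_cast Nat.pos_of_ne_zero (by simpa [Nat.descFactorial_eq_zero_iff_lt] using hTN)
  refine le_of_mul_le_mul_right ?_ hd
  calc _ ≤ (b : ℝ) ^ #S * m ^ #T * Fintype.card (β ≃ Fin N) := by exact_mod_cast hcard
    _ = (b : ℝ) ^ #S * m ^ #T * Fintype.card (β ≃ Fin N) * ((N : ℝ) ^ #T / N ^ #T) := by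
        rw [div_self (by positivity), mul_one]
    _ ≤ (b : ℝ) ^ #S * m ^ #T * Fintype.card (β ≃ Fin N) *
        (Real.exp #T * N.descFactorial #T / N ^ #T) := by gcongr
    _ = _ := by
        rw [← Real.exp_one_pow, hTc, mul_pow, mul_pow, div_pow, div_pow, ← pow_mul, ← pow_mul,
          ← pow_mul]
        ring

theorem exists_isSpreadDist {ι α : Type*} [Fintype ι] [Fintype α] [DecidableEq α] {q : ℝ}
    {Fam : Finset α → Prop} (w : ι → ℝ) (M : ι → Finset α) (hw : ∀ i, 0 ≤ w i)
    (h1 : ∑ i, w i = 1) (hF : ∀ i, w i ≠ 0 → Fam (M i))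
    (hS : ∀ S : Finset α, ∑ i with S ⊆ M i, w i ≤ q ^ #S) : ∃ μ, IsSpreadDist q Fam μ := by
  refine ⟨fun A => ∑ i with M i = A, w i, fun A => Finset.sum_nonneg fun i _ => hw i, ?_, ?_, ?_⟩
  · rw [Finset.sum_fiberwise, h1]
  · intro A hA
    obtain ⟨i, hi, hi'⟩ := Finset.exists_ne_zero_of_sum_ne_zero hA
    exact (mem_filter.1 hi).2 ▸ hF i hi'
  · intro S
    refine le_trans (le_of_eq ?_) (hS S)
    rw [Finset.sum_filter, Finset.sum_congr rfl (g := fun A => ∑ i with M i = A,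
      if S ⊆ M i then w i else 0), Finset.sum_fiberwise, Finset.sum_filter]
    intro A _
    split_ifs with h
    · refine Finset.sum_congr rfl fun i hi => ?_
      rw [(mem_filter.1 hi).2, if_pos h]
    · symm
      refine Finset.sum_eq_zero fun i hi => ?_
      rw [(mem_filter.1 hi).2, if_neg h]

/-- `T` is the vertex set of a matching of `H`. -/
def IsCoveredExactly {β : Type*} [DecidableEq β] (H : Finset (Finset β)) (T : Finset β) : Prop :=
  ∃ M ⊆ H, (M : Set (Finset β)).PairwiseDisjoint id ∧ M.biUnion id = T

theorem IsCoveredExactly.of_hyperPM {β : Type*} [DecidableEq β] {H : Finset (Finset β)} {k m : ℕ}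
    {x : Fin m → β} (hx : Function.Injective x) {M : Finset (Finset (Fin m))}
    (hM : HyperPM (pullbackHypergraph H k x) M) : IsCoveredExactly H (univ.image x) := by
  obtain ⟨hM1, hM2, hM3⟩ := hM
  refine ⟨M.image (fun e => e.image x), ?_, ?_, ?_⟩
  · intro e he
    obtain ⟨a, ha, rfl⟩ := mem_image.1 he
    exact (mem_filter.1 (hM1 ha)).2
  · intro e he e' he' hne
    simp only [coe_image, Set.mem_image, mem_coe] at he he'
    obtain ⟨a, ha, rfl⟩ := he
    obtain ⟨a', ha', rfl⟩ := he'
    exact (disjoint_image hx).2 (hM2 ha ha' fun h => hne (by rw [h]))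
  · rw [← hM3]
    ext v
    simp only [mem_biUnion, mem_image, id]
    constructor
    · rintro ⟨_, ⟨a, ha, rfl⟩, hv⟩
      obtain ⟨i, hi, rfl⟩ := mem_image.1 hv
      exact ⟨i, ⟨a, ha, hi⟩, rfl⟩
    · rintro ⟨i, ⟨a, ha, hi⟩, rfl⟩
      exact ⟨_, ⟨a, ha, rfl⟩, mem_image_of_mem _ hi⟩

open Classical in
theorem card_not_isCoveredExactly_le {β : Type*} [Fintype β] [DecidableEq β]
    (H : Finset (Finset β)) {k m N : ℕ} (hm : 0 < m) {j : ℕ}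
    (hj : j < N / m) :
    #{τ : β ≃ Fin N | ¬ IsCoveredExactly H {v | (τ v : ℕ) / m = j}} * N.descFactorial m ≤
      #{x : Fin m → β | Function.Injective x ∧ ¬ ∃ M, HyperPM (pullbackHypergraph H k x) M} *
        Fintype.card (β ≃ Fin N) := by
  have hjm : j * m + m ≤ N := by
    calc j * m + m = (j + 1) * m := by ring
      _ ≤ N / m * m := Nat.mul_le_mul_right _ hj
      _ ≤ N := Nat.div_mul_le_self _ _
  let emb : Fin m → Fin N := fun i => ⟨j * m + i, by omega⟩
  have hemb : Function.Injective emb := fun a b h => by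
    simp only [emb, Fin.mk.injEq] at h
    exact Fin.ext (by omega)
  set X : Finset (Fin m → β) :=
    {x | Function.Injective x ∧ ¬ ∃ M, HyperPM (pullbackHypergraph H k x) M} with hX
  have hsub : ({τ : β ≃ Fin N | ¬ IsCoveredExactly H {v | (τ v : ℕ) / m = j}} : Finset _) ⊆
      X.biUnion fun x => {τ : β ≃ Fin N | ∀ i, τ (x i) = emb i} := by
    intro τ hτ
    simp only [mem_filter, mem_univ, true_and] at hτ
    refine mem_biUnion.2 ⟨fun i => τ.symm (emb i), ?_, by simp⟩
    have hinj : Function.Injective fun i => τ.symm (emb i) := τ.symm.injective.comp hemb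
    simp only [hX, mem_filter, mem_univ, true_and]
    refine ⟨hinj, ?_⟩
    rintro ⟨M, hM⟩
    apply hτ
    convert IsCoveredExactly.of_hyperPM hinj hM using 1
    ext v
    simp only [mem_filter, mem_univ, true_and, mem_image]
    constructor
    · intro h
      have h1 := Nat.div_add_mod (τ v : ℕ) m
      refine ⟨⟨(τ v : ℕ) % m, Nat.mod_lt _ hm⟩, ?_⟩
      rw [Equiv.symm_apply_eq]
      ext
      simp only [emb]
      rw [← h, mul_comm]
      exact h1
    · rintro ⟨i, rfl⟩
      simp only [Equiv.apply_symm_apply, emb]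
      rw [mul_comm, Nat.mul_add_div hm, Nat.div_eq_of_lt i.2, add_zero]
  calc _ ≤ (∑ x ∈ X, #{τ : β ≃ Fin N | ∀ i, τ (x i) = emb i}) * N.descFactorial m := by
        gcongr
        exact (card_le_card hsub).trans card_biUnion_le
    _ = ∑ x ∈ X, #{τ : β ≃ Fin N | ∀ i, τ (x i) = emb i} * N.descFactorial m := by
        rw [Finset.sum_mul]
    _ ≤ ∑ x ∈ X, Fintype.card (β ≃ Fin N) := by
        refine Finset.sum_le_sum fun x hx => ?_
        have h := card_equiv_extending_mul_le x (mem_filter.1 hx).2.1 emb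
        rw [Fintype.card_fin, Fintype.card_fin] at h
        refine le_of_eq_of_le ?_ h
        congr!
    _ = _ := by simp

open Classical in
theorem exists_isSpreadDist_almost_perfect {β : Type*} [Fintype β] [DecidableEq β] [Nonempty β]
    (H : Finset (Finset β)) {k m N : ℕ} (hN : Fintype.card β = N)
    (hH : ∀ e ∈ H, #e = k) (hm : 0 < m) (hmN : m ≤ N) {γ : ℝ} (hγ : 0 < γ)
    (hbad : (#{x : Fin m → β | Function.Injective x ∧
      ¬ ∃ M, HyperPM (pullbackHypergraph H k x) M} : ℝ) ≤ γ * N.descFactorial m) :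
    ∃ μ, IsSpreadDist (2 * ((2 * N) * m ^ k * (Real.exp 1 / N) ^ k))
      (fun M : Finset (Finset β) => M ⊆ H ∧ (M : Set (Finset β)).PairwiseDisjoint id ∧
        (#(univ \ M.biUnion id) : ℝ) ≤ m + 2 * γ * N) μ := by
  have hN0 : 0 < N := hm.trans_le hmN
  set b := N / m + 1 with hb
  let blk : (β ≃ Fin N) → ℕ → Finset β := fun τ j => {v | (τ v : ℕ) / m = j}
  have hblk : ∀ τ j, #(blk τ j) ≤ m := by
    intro τ j
    calc _ = #((blk τ j).map (τ.toEmbedding.trans Fin.valEmbedding)) := (card_map _).symm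
      _ ≤ #(Finset.Ico (m * j) (m * j + m)) := by
          refine card_le_card fun x hx => ?_
          obtain ⟨v, hv, rfl⟩ := Finset.mem_map.1 hx
          simp only [blk, mem_filter, mem_univ, true_and] at hv
          simp only [Finset.mem_Ico, ← hv, Function.Embedding.trans_apply, Equiv.coe_toEmbedding,
            Fin.valEmbedding_apply]
          have h1 := Nat.div_add_mod (τ v : ℕ) m
          have h2 := Nat.mod_lt (τ v : ℕ) hm
          omega
      _ = m := by simp
  have hPM : ∀ T : Finset β, ∃ M ⊆ H, (M : Set (Finset β)).PairwiseDisjoint id ∧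
      M.biUnion id ⊆ T ∧ (IsCoveredExactly H T → M.biUnion id = T) := by
    intro T
    by_cases hT : IsCoveredExactly H T
    · obtain ⟨M, h1, h2, h3⟩ := hT
      exact ⟨M, h1, h2, h3.subset, fun _ => h3⟩
    · exact ⟨∅, by simp, by simp, by simp, fun h => absurd h hT⟩
  choose PM hPM1 hPM2 hPM3 hPM4 using hPM
  have hPM3' : ∀ T, ∀ e ∈ PM T, e ⊆ T := fun T e he =>
    (Finset.subset_biUnion_of_mem id he).trans (hPM3 T)
  let M : (β ≃ Fin N) → Finset (Finset β) := fun τ => (range b).biUnion fun j => PM (blk τ j)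
  let X : (β ≃ Fin N) → ℕ := fun τ => #{j ∈ range (N / m) | ¬ IsCoveredExactly H (blk τ j)}
  have hMH : ∀ τ, M τ ⊆ H := fun τ => biUnion_subset.2 fun j _ => hPM1 _
  have hMd : ∀ τ, (M τ : Set (Finset β)).PairwiseDisjoint id := by
    intro τ e he e' he' hne
    simp only [M, coe_biUnion, Set.mem_iUnion, mem_coe, mem_range, exists_prop] at he he'
    obtain ⟨j, -, he⟩ := he
    obtain ⟨j', -, he'⟩ := he'
    by_cases hjj : j = j'
    · subst hjj
      exact hPM2 _ he he' hne
    · refine Finset.disjoint_left.2 fun v hv hv' => hjj ?_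
      have h1 := hPM3' _ _ he hv
      have h2 := hPM3' _ _ he' hv'
      simp only [blk, mem_filter, mem_univ, true_and] at h1 h2
      rw [← h1, ← h2]
  have hunc : ∀ τ, #(univ \ (M τ).biUnion id) ≤ m * (X τ + 1) := by
    intro τ
    have h1 : univ \ (M τ).biUnion id ⊆
        ({j ∈ range b | ¬ IsCoveredExactly H (blk τ j)} : Finset ℕ).biUnion (blk τ) := by
      intro v hv
      simp only [mem_sdiff, mem_univ, true_and] at hv
      have hvj : v ∈ blk τ ((τ v : ℕ) / m) := by simp [blk]
      have hjb : (τ v : ℕ) / m < b := Nat.lt_succ_of_le (Nat.div_le_div_right (τ v).2.le)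
      refine mem_biUnion.2 ⟨(τ v : ℕ) / m, mem_filter.2 ⟨mem_range.2 hjb, fun hc => hv ?_⟩, hvj⟩
      rw [← hPM4 _ hc] at hvj
      obtain ⟨e, he, hve⟩ := mem_biUnion.1 hvj
      exact mem_biUnion.2 ⟨e, mem_biUnion.2 ⟨_, mem_range.2 hjb, he⟩, hve⟩
    have h2 : #{j ∈ range b | ¬ IsCoveredExactly H (blk τ j)} ≤ X τ + 1 := by
      rw [hb, Finset.range_add_one, Finset.filter_insert]
      split_ifs
      · exact Nat.le_succ _
      · exact card_insert_le _ _
    calc _ ≤ ∑ j ∈ range b with ¬ IsCoveredExactly H (blk τ j), #(blk τ j) :=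
          (card_le_card h1).trans card_biUnion_le
      _ ≤ ∑ j ∈ range b with ¬ IsCoveredExactly H (blk τ j), m :=
          Finset.sum_le_sum fun j _ => hblk τ j
      _ ≤ _ := by
          rw [sum_const, smul_eq_mul, mul_comm]
          gcongr
  set Om : ℝ := (Fintype.card (β ≃ Fin N) : ℝ) with hOm
  have hOm0 : 0 < Om := by
    have : Nonempty (β ≃ Fin N) := ⟨Fintype.equivFinOfCardEq hN⟩
    simp [hOm, Fintype.card_pos]
  have hd : (0 : ℝ) < N.descFactorial m := by
    exact_mod_cast Nat.pos_of_ne_zero (by simpa [Nat.descFactorial_eq_zero_iff_lt] using hmN)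
  have hm' : (0 : ℝ) < m := by exact_mod_cast hm
  have hN' : (0 : ℝ) < N := by exact_mod_cast hN0
  have hbadj : ∀ j ∈ range (N / m),
      (#{τ : β ≃ Fin N | ¬ IsCoveredExactly H (blk τ j)} : ℝ) ≤ γ * Om := by
    intro j hj
    have h1 := card_not_isCoveredExactly_le H (k := k) hm (mem_range.1 hj)
    have h2 : (#{τ : β ≃ Fin N | ¬ IsCoveredExactly H (blk τ j)} : ℝ) * N.descFactorial m ≤
      #{x : Fin m → β | Function.Injective x ∧ ¬ ∃ M, HyperPM (pullbackHypergraph H k x) M} *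
        Om := by
      rw [hOm]; exact_mod_cast h1
    refine le_of_mul_le_mul_right ?_ hd
    calc _ ≤ _ := h2
      _ ≤ γ * N.descFactorial m * Om := by gcongr
      _ = _ := by ring
  have hXsum : ∑ τ, (X τ : ℝ) ≤ N / m * (γ * Om) := by
    calc ∑ τ, (X τ : ℝ) = ∑ j ∈ range (N / m),
          (#{τ : β ≃ Fin N | ¬ IsCoveredExactly H (blk τ j)} : ℝ) := by
          simp only [X, Finset.card_filter, Nat.cast_sum]
          rw [Finset.sum_comm]
      _ ≤ ∑ j ∈ range (N / m), γ * Om := Finset.sum_le_sum hbadj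
      _ = (N / m : ℕ) * (γ * Om) := by simp
      _ ≤ _ := by
          gcongr
          exact Nat.cast_div_le
  set t : ℝ := 2 * γ * N / m with ht
  have ht0 : 0 < t := by positivity
  set G : Finset (β ≃ Fin N) := {τ | (X τ : ℝ) ≤ t} with hG
  have hGc : Om / 2 ≤ #G := by
    have h1 : (#{τ : β ≃ Fin N | ¬ (X τ : ℝ) ≤ t} : ℝ) * t ≤ Om / 2 * t := by
      calc _ = ∑ τ : β ≃ Fin N with ¬ (X τ : ℝ) ≤ t, t := by simp
        _ ≤ ∑ τ : β ≃ Fin N with ¬ (X τ : ℝ) ≤ t, (X τ : ℝ) :=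
            Finset.sum_le_sum fun τ hτ => (not_le.1 (mem_filter.1 hτ).2).le
        _ ≤ ∑ τ, (X τ : ℝ) :=
            Finset.sum_le_sum_of_subset_of_nonneg (by simp) fun _ _ _ => by positivity
        _ ≤ N / m * (γ * Om) := hXsum
        _ = _ := by rw [ht]; ring
    have h2 := le_of_mul_le_mul_right h1 ht0
    have h3 := Finset.card_filter_add_card_filter_not (s := (univ : Finset (β ≃ Fin N)))
      (fun τ => (X τ : ℝ) ≤ t)
    have h4 : (#G : ℝ) + #{τ : β ≃ Fin N | ¬ (X τ : ℝ) ≤ t} = Om := by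
      rw [hOm, hG]; exact_mod_cast h3
    linarith
  have hG0 : (0 : ℝ) < #G := by linarith
  have hbN : (b : ℝ) ≤ 2 * N := by
    have : b ≤ 2 * N := by
      have := Nat.div_le_self N m
      omega
    exact_mod_cast this
  refine exists_isSpreadDist (fun τ => if τ ∈ G then (#G : ℝ)⁻¹ else 0) M ?_ ?_ ?_ ?_
  · intro τ
    split_ifs <;> positivity
  · simp [hG0.ne']
  · intro τ hτ
    have hτG : τ ∈ G := by
      by_contra h
      simp [h] at hτ
    refine ⟨hMH τ, hMd τ, ?_⟩
    have h1 : (#(univ \ (M τ).biUnion id) : ℝ) ≤ m * (X τ + 1) := by exact_mod_cast hunc τ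
    have h2 : (X τ : ℝ) ≤ t := (mem_filter.1 hτG).2
    calc _ ≤ _ := h1
      _ ≤ m * (t + 1) := by gcongr
      _ = _ := by rw [ht]; field_simp; ring
  · intro S
    set Q : ℝ := 2 * N * m ^ k * (Real.exp 1 / N) ^ k with hQ
    have hQ0 : 0 ≤ Q := by positivity
    have hle : ∑ τ with S ⊆ M τ, (if τ ∈ G then (#G : ℝ)⁻¹ else 0) ≤
        #{τ | S ⊆ M τ} * (#G : ℝ)⁻¹ := by
      rw [← nsmul_eq_mul, ← Finset.sum_const]
      refine Finset.sum_le_sum fun τ _ => ?_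
      split_ifs
      · exact le_rfl
      · positivity
    rcases S.eq_empty_or_nonempty with rfl | hne
    · simp [hG0.ne']
    · have hcount : (#{τ | S ⊆ M τ} : ℝ) ≤ Q ^ #S * Om := by
        rcases Finset.eq_empty_or_nonempty ({τ | S ⊆ M τ} : Finset (β ≃ Fin N)) with h0 | ⟨τ₀, hτ₀⟩
        · rw [h0]
          simp only [card_empty, Nat.cast_zero]
          positivity
        · have hτ₀ := (mem_filter.1 hτ₀).2
          have h1 := card_monochromatic_le (b := b) hN hm S
            ((hMd τ₀).subset (by exact_mod_cast hτ₀)) fun e he => hH e (hMH τ₀ (hτ₀ he))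
          calc (#{τ | S ⊆ M τ} : ℝ) ≤
              #{τ : β ≃ Fin N | ∀ e ∈ S, ∃ j < b, ∀ v ∈ e, (τ v : ℕ) / m = j} := by
                rw [Nat.cast_le]
                refine card_le_card fun τ hτ => ?_
                simp only [mem_filter, mem_univ, true_and] at hτ ⊢
                intro e he
                obtain ⟨j, hj, hej⟩ := mem_biUnion.1 (hτ he)
                refine ⟨j, mem_range.1 hj, fun v hv => ?_⟩
                have := hPM3' _ _ hej hv
                simpa [blk] using this
            _ ≤ _ := h1
            _ ≤ _ := by
                rw [hQ]
                gcongr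
      calc _ ≤ _ := hle
        _ ≤ Q ^ #S * Om * (Om / 2)⁻¹ := by gcongr
        _ = 2 * Q ^ #S := by field_simp
        _ ≤ 2 ^ #S * Q ^ #S := by
            gcongr
            exact le_self_pow₀ (by norm_num) hne.card_ne_zero
        _ = _ := (mul_pow _ _ _).symm

theorem IsSpreadDist.mono {α : Type*} [Fintype α] [DecidableEq α] {q q' : ℝ} {Fam : Finset α → Prop}
    {μ : Finset α → ℝ} (h : IsSpreadDist q Fam μ) (hq : 0 ≤ q) (hqq : q ≤ q') :
    IsSpreadDist q' Fam μ :=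
  ⟨h.1, h.2.1, h.2.2.1, fun S => (h.2.2.2 S).trans (pow_le_pow_left₀ hq hqq _)⟩

theorem IsSpreadDist.exists_map {α α' : Type*} [Fintype α] [DecidableEq α] [Fintype α']
    [DecidableEq α'] {q : ℝ} {Fam : Finset α → Prop} {μ : Finset α → ℝ}
    (h : IsSpreadDist q Fam μ) (hq : 0 ≤ q) (f : α ↪ α') :
    ∃ ν, IsSpreadDist q (fun A => ∃ A', Fam A' ∧ A = A'.map f) ν := by
  refine exists_isSpreadDist μ (fun A => A.map f) h.1 h.2.1
    (fun A hA => ⟨A, h.2.2.1 A hA, rfl⟩) fun S => ?_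
  rcases Finset.eq_empty_or_nonempty ({A | S ⊆ A.map f} : Finset (Finset α)) with h0 | ⟨A, hA⟩
  · rw [h0, Finset.sum_empty]
    positivity
  · obtain ⟨S', -, rfl⟩ := Finset.subset_map_iff.1 (mem_filter.1 hA).2
    simp only [Finset.map_subset_map, card_map]
    exact h.2.2.2 S'

theorem IsSpreadDist.exists_union {α : Type*} [Fintype α] [DecidableEq α] {q : ℝ}
    {Fam₁ Fam : Finset α → Prop} {Fam₂ : Finset α → Finset α → Prop} (P : α → Prop)
    [DecidablePred P] {μ : Finset α → ℝ} (h : IsSpreadDist q Fam₁ μ)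
    (h₂ : ∀ A, Fam₁ A → ∃ ν, IsSpreadDist q (Fam₂ A) ν) (hP₁ : ∀ A, Fam₁ A → ∀ a ∈ A, P a)
    (hP₂ : ∀ A B, Fam₂ A B → ∀ b ∈ B, ¬ P b)
    (hFam : ∀ A B, Fam₁ A → Fam₂ A B → Fam (A ∪ B)) (hq : 0 ≤ q) :
    ∃ ν, IsSpreadDist q Fam ν := by
  have h₃ : ∀ A, ∃ ν : Finset α → ℝ, μ A ≠ 0 → IsSpreadDist q (Fam₂ A) ν := by
    intro A
    by_cases hA : μ A ≠ 0
    · obtain ⟨ν, hν⟩ := h₂ A (h.2.2.1 A hA)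
      exact ⟨ν, fun _ => hν⟩
    · exact ⟨0, fun hA' => absurd hA' hA⟩
  choose ν hν using h₃
  obtain ⟨hμ0, hμ1, hμF, hμS⟩ := h
  have hw : ∀ A B, 0 ≤ μ A * ν A B := by
    intro A B
    by_cases hA : μ A = 0
    · simp [hA]
    · exact mul_nonneg (hμ0 A) ((hν A hA).1 B)
  refine exists_isSpreadDist (ι := Finset α × Finset α) (fun x => μ x.1 * ν x.1 x.2)
    (fun x => x.1 ∪ x.2) (fun x => hw _ _) ?_ ?_ ?_
  · rw [Fintype.sum_prod_type, ← hμ1]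
    refine Finset.sum_congr rfl fun A _ => ?_
    simp only
    rw [← Finset.mul_sum]
    by_cases hA : μ A = 0
    · simp [hA]
    · rw [(hν A hA).2.1, mul_one]
  · rintro ⟨A, B⟩ hAB
    have hA := left_ne_zero_of_mul hAB
    exact hFam A B (hμF A hA) ((hν A hA).2.2.1 B (right_ne_zero_of_mul hAB))
  · intro S
    set S₁ := S.filter P
    set S₂ := S.filter (¬ P ·)
    have hle : ∀ A B, (if S ⊆ A ∪ B then μ A * ν A B else 0) ≤
        if S₁ ⊆ A then (if S₂ ⊆ B then μ A * ν A B else 0) else 0 := by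
      intro A B
      by_cases hAB : μ A * ν A B = 0
      · simp [hAB]
      have hA := left_ne_zero_of_mul hAB
      have hA1 := hP₁ A (hμF A hA)
      have hB1 := hP₂ A B ((hν A hA).2.2.1 B (right_ne_zero_of_mul hAB))
      split_ifs with h1 h2 h3 h4 h5
      · exact le_rfl
      · refine absurd (fun a ha => ?_) h3
        have ha := mem_filter.1 ha
        exact (mem_union.1 (h1 ha.1)).resolve_left fun h => ha.2 (hA1 a h)
      · refine absurd (fun a ha => ?_) h2
        have ha := mem_filter.1 ha
        exact (mem_union.1 (h1 ha.1)).resolve_right fun h => (hB1 a h) ha.2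
      · exact hw A B
      · exact le_rfl
      · exact le_rfl
    rw [Finset.sum_filter, Fintype.sum_prod_type]
    calc _ ≤ ∑ A : Finset α, ∑ B : Finset α,
          (if S₁ ⊆ A then (if S₂ ⊆ B then μ A * ν A B else 0) else 0) :=
          Finset.sum_le_sum fun A _ => Finset.sum_le_sum fun B _ => hle A B
      _ = ∑ A : Finset α with S₁ ⊆ A, μ A * ∑ B : Finset α with S₂ ⊆ B, ν A B := by
          rw [Finset.sum_filter]
          refine Finset.sum_congr rfl fun A _ => ?_
          split_ifs
          · rw [Finset.mul_sum, Finset.sum_filter]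
          · simp
      _ ≤ ∑ A : Finset α with S₁ ⊆ A, μ A * q ^ #S₂ := by
          refine Finset.sum_le_sum fun A _ => ?_
          by_cases hA : μ A = 0
          · simp [hA]
          · exact mul_le_mul_of_nonneg_left ((hν A hA).2.2.2 S₂) (hμ0 A)
      _ ≤ q ^ #S₁ * q ^ #S₂ := by
          rw [← Finset.sum_mul]
          exact mul_le_mul_of_nonneg_right (hμS S₁) (by positivity)
      _ = q ^ #S := by
          rw [← pow_add, Finset.card_filter_add_card_filter_not]

/-- `M` is a matching of `H` each of whose edges has exactly one vertex outside `U`, the set of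
these vertices being `R`. -/
def IsCrossingMatching {V : Type*} [DecidableEq V] (H : Finset (Finset V)) (U R : Finset V)
    (M : Finset (Finset V)) : Prop :=
  M ⊆ H ∧ (M : Set (Finset V)).PairwiseDisjoint id ∧ M.biUnion id \ U = R ∧ ∀ e ∈ M, #(e \ U) = 1

theorem IsCrossingMatching.card_inter {V : Type*} [DecidableEq V] {H : Finset (Finset V)} {k : ℕ}
    (hH : ∀ e ∈ H, #e = k) {U R : Finset V} {M : Finset (Finset V)}
    (hM : IsCrossingMatching H U R M) : #(M.biUnion id ∩ U) ≤ k * #R := by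
  obtain ⟨h1, h2, h3, h4⟩ := hM
  have h5 : #R = #M := by
    have : M.biUnion id \ U = M.biUnion fun e => e \ U := by
      ext v
      simp only [mem_sdiff, mem_biUnion, id]
      tauto
    rw [← h3, this, card_biUnion, sum_congr rfl h4]
    · simp
    · exact fun e he e' he' hne => (h2 he he' hne).mono sdiff_subset sdiff_subset
  calc _ ≤ #(M.biUnion id) := card_le_card inter_subset_left
    _ ≤ ∑ e ∈ M, #e := card_biUnion_le
    _ = k * #R := by rw [sum_congr rfl fun e he => hH e (h1 he), h5]; simp [mul_comm]

theorem exists_isSpreadDist_isCrossingMatching {V : Type*} [Fintype V] [DecidableEq V]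
    {H : Finset (Finset V)} {k : ℕ} (hH : ∀ e ∈ H, #e = k) {U : Finset V} {q : ℝ} (hq : 0 < q)
    {D : ℕ} (R : Finset V) (hRU : Disjoint R U) (hRD : k * #R ≤ D)
    (hav : ∀ v ∈ R, ∀ X ⊆ U, #X ≤ D → q⁻¹ ≤ #{e ∈ H | v ∈ e ∧ e \ {v} ⊆ U \ X}) :
    ∃ μ, IsSpreadDist q (IsCrossingMatching H U R) μ := by
  induction R using Finset.induction_on with
  | empty =>
    refine exists_isSpreadDist (ι := Unit) (fun _ => 1) (fun _ => ∅) (by simp) (by simp)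
      (by simp [IsCrossingMatching]) fun S => ?_
    by_cases hS : S = ∅
    · simp [hS]
    · simp only [subset_empty, hS, filter_false, sum_empty]
      positivity
  | insert v R hvR ih =>
    rw [card_insert_of_notMem hvR] at hRD
    obtain ⟨μ, hμ0, hμ1, hμF, hμS⟩ := ih (hRU.mono_left (subset_insert _ _))
      (le_trans (Nat.mul_le_mul_left _ (Nat.le_succ _)) hRD)
      fun u hu => hav u (mem_insert_of_mem hu)
    have hvU : v ∉ U := fun h => Finset.disjoint_left.1 hRU (mem_insert_self v R) h
    set E : Finset (Finset V) → Finset (Finset V) := fun A =>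
      {e ∈ H | v ∈ e ∧ e \ {v} ⊆ U \ (A.biUnion id ∩ U)} with hE
    have hEc : ∀ A, μ A ≠ 0 → q⁻¹ ≤ #(E A) := by
      intro A hA
      refine hav v (mem_insert_self _ _) _ inter_subset_right ?_
      exact ((hμF A hA).card_inter hH).trans
        (le_trans (Nat.mul_le_mul_left _ (Nat.le_succ _)) hRD)
    have hvA : ∀ A, μ A ≠ 0 → ∀ e ∈ A, v ∉ e := by
      intro A hA e he hve
      obtain ⟨-, -, h3, -⟩ := hμF A hA
      apply hvR
      rw [← h3]
      exact mem_sdiff.2 ⟨mem_biUnion.2 ⟨e, he, hve⟩, hvU⟩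
    set w : Finset (Finset V) → Finset V → ℝ := fun A e => if e ∈ E A then μ A / #(E A) else 0
      with hw
    have hw0 : ∀ A e, 0 ≤ w A e := by
      intro A e
      have := hμ0 A
      simp only [hw]
      split_ifs <;> positivity
    have hwA : ∀ A e, w A e ≠ 0 → μ A ≠ 0 ∧ e ∈ E A := by
      intro A e h
      simp only [hw] at h
      split_ifs at h with h1
      · exact ⟨fun h0 => h (by simp [h0]), h1⟩
      · exact absurd rfl h
    have hwsum : ∀ A, ∑ e, w A e = μ A := by
      intro A
      simp only [hw]
      rw [← Finset.sum_filter]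
      simp only [filter_mem_eq_inter, univ_inter, sum_const, nsmul_eq_mul]
      by_cases hA : μ A = 0
      · simp [hA]
      · have : (0 : ℝ) < #(E A) := lt_of_lt_of_le (by positivity) (hEc A hA)
        field_simp
    have hwq : ∀ A e, w A e ≤ μ A * q := by
      intro A e
      by_cases h : w A e = 0
      · rw [h]
        exact mul_nonneg (hμ0 A) hq.le
      · obtain ⟨hA, he⟩ := hwA A e h
        simp only [hw, if_pos he]
        rw [div_eq_mul_inv]
        exact mul_le_mul_of_nonneg_left (inv_le_of_inv_le₀ hq (hEc A hA)) (hμ0 A)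
    refine exists_isSpreadDist (ι := Finset (Finset V) × Finset V) (fun x => w x.1 x.2)
      (fun x => insert x.2 x.1) (fun x => hw0 _ _) ?_ ?_ ?_
    · rw [Fintype.sum_prod_type, ← hμ1]
      exact Finset.sum_congr rfl fun A _ => hwsum A
    · rintro ⟨A, e⟩ hAe
      obtain ⟨hA, he⟩ := hwA A e hAe
      have hvA := hvA A hA
      obtain ⟨h1, h2, h3, h4⟩ := hμF A hA
      simp only [hE, mem_filter] at he
      obtain ⟨heH, hve, heU⟩ := he
      have heU' : e \ U = {v} := by
        ext u
        simp only [mem_sdiff, mem_singleton]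
        constructor
        · rintro ⟨hu, huU⟩
          by_contra huv
          exact huU (mem_sdiff.1 (heU (mem_sdiff.2 ⟨hu, by simpa using huv⟩))).1
        · rintro rfl
          exact ⟨hve, hvU⟩
      refine ⟨insert_subset heH h1, ?_, ?_, ?_⟩
      · rw [coe_insert]
        refine h2.insert fun a ha _ => ?_
        refine Finset.disjoint_left.2 fun u hu hua => ?_
        by_cases huv : u = v
        · exact hvA a ha (huv ▸ hua)
        · have h5 := mem_sdiff.1 (heU (mem_sdiff.2 ⟨hu, by simpa using huv⟩))
          exact h5.2 (mem_inter.2 ⟨mem_biUnion.2 ⟨a, ha, hua⟩, h5.1⟩)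
      · rw [biUnion_insert, union_sdiff_distrib, h3, id, heU', singleton_union]
      · intro a ha
        rcases mem_insert.1 ha with rfl | ha
        · rw [heU', card_singleton]
        · exact h4 a ha
    · intro S
      rw [Finset.sum_filter, Fintype.sum_prod_type]
      by_cases hS : ∃ e₀ ∈ S, v ∈ e₀
      · obtain ⟨e₀, he₀, hve₀⟩ := hS
        calc _ ≤ ∑ A : Finset (Finset V), if S.erase e₀ ⊆ A then w A e₀ else 0 := by
              refine Finset.sum_le_sum fun A _ => ?_
              rw [Finset.sum_eq_single e₀]
              · split_ifs with h1 h2 h2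
                · exact le_rfl
                · exact absurd (subset_insert_iff.1 h1) h2
                · exact hw0 _ _
                · exact le_rfl
              · intro e _ hne
                by_contra hcon
                have hsub : S ⊆ insert e A := by
                  by_contra h
                  exact hcon (if_neg h)
                have hwe : w A e ≠ 0 := by
                  simpa only [if_pos hsub] using hcon
                obtain ⟨hA, he⟩ := hwA A e hwe
                rcases mem_insert.1 (hsub he₀) with h | h
                · exact hne h.symm
                · exact hvA A hA _ h hve₀
              · simp
          _ ≤ ∑ A : Finset (Finset V) with S.erase e₀ ⊆ A, μ A * q := by
              rw [← Finset.sum_filter]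
              exact Finset.sum_le_sum fun A _ => hwq A e₀
          _ ≤ q ^ #(S.erase e₀) * q := by
              rw [← Finset.sum_mul]
              exact mul_le_mul_of_nonneg_right (hμS _) hq.le
          _ = q ^ #S := by
              rw [← pow_succ, card_erase_add_one he₀]
      · push Not at hS
        refine le_trans ?_ (hμS S)
        rw [Finset.sum_filter]
        refine Finset.sum_le_sum fun A _ => ?_
        split_ifs with hSA
        · rw [← hwsum A]
          refine Finset.sum_le_sum fun e _ => ?_
          split_ifs
          · exact le_rfl
          · exact hw0 _ _
        · refine Finset.sum_nonpos fun e _ => ?_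
          split_ifs with h
          · by_contra hcon
            obtain ⟨hA, he⟩ := hwA A e (by linarith [not_le.1 hcon] : 0 < w A e).ne'
            refine hSA fun a ha => ?_
            refine (mem_insert.1 (h ha)).resolve_left ?_
            rintro rfl
            exact hS _ ha (mem_filter.1 he).2.1
          · exact le_rfl

theorem factorial_mul_card_le_card_tuples {V : Type*} [Fintype V] [DecidableEq V] [Nonempty V]
    {H : Finset (Finset V)} {k l r : ℕ} (hk : k = l + r) (hH : ∀ e ∈ H, #e = k) {S : Finset V}
    (hS : #S = l) :
    r.factorial * #{e ∈ H | S ⊆ e} ≤ #{y : Fin r → V | S ∪ univ.image y ∈ H} := by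
  have h0 : ∀ e ∈ H, S ⊆ e → Fintype.card (Fin r) = Fintype.card {x // x ∈ e \ S} := by
    intro e he hSe
    rw [Fintype.card_fin, Fintype.card_coe, card_sdiff_of_subset hSe, hH e he, hS, hk]
    omega
  have h1 : ∀ e : Finset V, ∃ y : Fin r → V, e ∈ H → S ⊆ e →
      Function.Injective y ∧ univ.image y = e \ S := by
    intro e
    by_cases h : e ∈ H ∧ S ⊆ e
    · let g := Fintype.equivOfCardEq (h0 e h.1 h.2)
      refine ⟨fun i => g i, fun _ _ => ⟨Subtype.val_injective.comp g.injective, ?_⟩⟩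
      ext v
      simp only [mem_image, mem_univ, true_and]
      constructor
      · rintro ⟨i, rfl⟩
        exact (g i).2
      · intro hv
        exact ⟨g.symm ⟨v, hv⟩, by simp⟩
    · exact ⟨fun _ => Classical.arbitrary V, fun a b => absurd ⟨a, b⟩ h⟩
  choose y hy using h1
  have him : ∀ (e : Finset V) (π : Equiv.Perm (Fin r)),
      univ.image (fun i => y e (π i)) = univ.image (y e) := by
    intro e π
    ext v
    simp only [mem_image, mem_univ, true_and]
    exact π.exists_congr_left.trans (by simp)
  rw [← Fintype.card_fin r, ← Fintype.card_perm, ← card_univ, ← card_product, Fintype.card_fin]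
  refine Finset.card_le_card_of_injOn (fun x i => y x.2 (x.1 i)) ?_ ?_
  · rintro ⟨π, e⟩ he
    simp only [coe_product, coe_filter, Set.mem_prod, Set.mem_ofPred_eq] at he
    simp only [coe_filter, Set.mem_ofPred_eq, mem_univ, true_and]
    rw [him, (hy e he.2.1 he.2.2).2, union_sdiff_of_subset he.2.2]
    exact he.2.1
  · rintro ⟨π, e⟩ he ⟨π', e'⟩ he' h
    simp only [coe_product, coe_filter, Set.mem_prod, Set.mem_ofPred_eq] at he he' h
    have hee : e = e' := by
      have := congrArg (fun z => S ∪ univ.image z) h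
      simp only [him] at this
      rwa [(hy e he.2.1 he.2.2).2, (hy e' he'.2.1 he'.2.2).2, union_sdiff_of_subset he.2.2,
        union_sdiff_of_subset he'.2.2] at this
    subst hee
    simp only [Prod.mk.injEq, and_true]
    ext1 i
    exact (hy e he.2.1 he.2.2).1 (congrFun h i)

/-- The edges of `H` avoiding `U`, as a hypergraph on the complement of `U`. -/
def avoidingHypergraph {V : Type*} [Fintype V] [DecidableEq V] (H : Finset (Finset V))
    (U : Finset V) : Finset (Finset {v // v ∉ U}) :=
  {e | e.map (Function.Embedding.subtype _) ∈ H}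

theorem card_tuples_le {V : Type*} [Fintype V] [DecidableEq V] (H : Finset (Finset V))
    (U : Finset V) (r : ℕ) (S : Finset {v // v ∉ U}) :
    #{y : Fin r → V | S.map (Function.Embedding.subtype _) ∪ univ.image y ∈ H} ≤
      #{y : Fin r → {v // v ∉ U} | S ∪ univ.image y ∈ avoidingHypergraph H U} +
        r * (#U * Fintype.card V ^ (r - 1)) := by
  have hcard : ∀ i : Fin r, #{y : Fin r → V | y i ∈ U} = #U * Fintype.card V ^ (r - 1) := by
    intro i
    have : ({y : Fin r → V | y i ∈ U} : Finset _) =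
        Fintype.piFinset fun j => if j = i then U else univ := by
      ext y
      simp only [mem_filter, mem_univ, true_and, Fintype.mem_piFinset]
      constructor
      · intro h j
        split_ifs with hj
        · exact hj ▸ h
        · exact mem_univ _
      · intro h
        simpa using h i
    rw [this, Fintype.card_piFinset, ← Finset.mul_prod_erase _ _ (mem_univ i), if_pos rfl,
      Finset.prod_congr rfl (g := fun _ => Fintype.card V)]
    · simp
    · intro j hj
      rw [if_neg (mem_erase.1 hj).1, card_univ]
  calc _ ≤ #(({y : Fin r → {v // v ∉ U} | S ∪ univ.image y ∈ avoidingHypergraph H U} :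
          Finset _).image (fun y i => (y i : V)) ∪
          univ.biUnion fun i : Fin r => {y : Fin r → V | y i ∈ U}) := by
        refine card_le_card fun y hy => ?_
        simp only [mem_filter, mem_univ, true_and] at hy
        by_cases hyU : ∃ i, y i ∈ U
        · obtain ⟨i, hi⟩ := hyU
          exact mem_union_right _ (mem_biUnion.2 ⟨i, mem_univ _, by simpa using hi⟩)
        · push Not at hyU
          refine mem_union_left _ (mem_image.2 ⟨fun i => ⟨y i, hyU i⟩, ?_, rfl⟩)
          simp only [avoidingHypergraph, mem_filter, mem_univ, true_and]
          rw [map_union, map_eq_image _ (univ.image _), image_image]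
          exact hy
    _ ≤ _ := by
        refine (card_union_le _ _).trans (Nat.add_le_add card_image_le ?_)
        refine card_biUnion_le.trans ?_
        simp [hcard]

theorem card_containing_two_le {V : Type*} [Fintype V] [DecidableEq V] {H : Finset (Finset V)}
    {k : ℕ} (hH : ∀ e ∈ H, #e = k) {u v : V} (huv : u ≠ v) :
    #{e ∈ H | u ∈ e ∧ v ∈ e} ≤ Fintype.card V ^ (k - 2) := by
  calc _ ≤ #(powersetCard (k - 2) (univ : Finset V)) := by
        refine Finset.card_le_card_of_injOn (fun e => e \ {u, v}) ?_ ?_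
        · intro e he
          simp only [coe_filter, Set.mem_ofPred_eq] at he
          have hs : {u, v} ⊆ e := insert_subset he.2.1 (singleton_subset_iff.2 he.2.2)
          simp [mem_powersetCard, card_sdiff_of_subset hs, hH e he.1, card_pair huv]
        · intro e he e' he' h
          simp only [coe_filter, Set.mem_ofPred_eq] at he he' h
          have hs : {u, v} ⊆ e := insert_subset he.2.1 (singleton_subset_iff.2 he.2.2)
          have hs' : {u, v} ⊆ e' := insert_subset he'.2.1 (singleton_subset_iff.2 he'.2.2)
          rw [← sdiff_union_of_subset hs, h, sdiff_union_of_subset hs']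
    _ ≤ _ := by
        rw [card_powersetCard, card_univ]
        exact Nat.choose_le_pow _ _

theorem card_crossing_le {V : Type*} [Fintype V] [DecidableEq V] {H : Finset (Finset V)}
    {k : ℕ} (hH : ∀ e ∈ H, #e = k) {U X : Finset V} {v : V} (hv : v ∉ U) (hX : X ⊆ U) :
    #{e ∈ H | v ∈ e ∧ e \ {v} ⊆ U} ≤
      #{e ∈ H | v ∈ e ∧ e \ {v} ⊆ U \ X} + #X * Fintype.card V ^ (k - 2) := by
  calc _ ≤ #({e ∈ H | v ∈ e ∧ e \ {v} ⊆ U \ X} ∪ X.biUnion fun x => {e ∈ H | v ∈ e ∧ x ∈ e}) := by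
        refine card_le_card fun e he => ?_
        obtain ⟨he, hve, heU⟩ := mem_filter.1 he
        by_cases h : ∃ x ∈ X, x ∈ e
        · obtain ⟨x, hx, hxe⟩ := h
          exact mem_union_right _ (mem_biUnion.2 ⟨x, hx, mem_filter.2 ⟨he, hve, hxe⟩⟩)
        · push Not at h
          refine mem_union_left _ (mem_filter.2 ⟨he, hve, fun u hu => mem_sdiff.2 ⟨heU hu, ?_⟩⟩)
          exact fun huX => h u huX (mem_sdiff.1 hu).1
    _ ≤ _ := by
        refine (card_union_le _ _).trans (Nat.add_le_add_left ?_ _)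
        refine card_biUnion_le_card_mul _ _ _ fun x hx => card_containing_two_le hH ?_
        rintro rfl
        exact hv (hX hx)

theorem sum_hDegOn_le {n k l : ℕ} {H : Finset (Finset (Fin n))} (hH : ∀ e ∈ H, #e = k)
    (U : Finset (Fin n)) (v : Fin n) :
    ∑ T ∈ powersetCard l U, hDegOn H (insert v T) U ≤
      2 ^ k * #{e ∈ H | v ∈ e ∧ e \ {v} ⊆ U} := by
  simp only [hDegOn, card_filter]
  rw [Finset.sum_comm]
  rw [Finset.mul_sum]
  refine Finset.sum_le_sum fun e he => ?_
  rw [← card_filter]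
  split_ifs with h
  · rw [mul_one, ← hH e he, ← card_powerset]
    refine card_le_card fun T hT => ?_
    exact mem_powerset.2 ((subset_insert _ _).trans (mem_filter.1 hT).2.1)
  · rw [mul_zero, Nat.le_zero, card_eq_zero, filter_eq_empty_iff]
    rintro T hT ⟨h1, h2⟩
    refine h ⟨h1 (mem_insert_self _ _), fun u hu => ?_⟩
    obtain ⟨hue, huv⟩ := mem_sdiff.1 hu
    by_cases huT : u ∈ T
    · exact (mem_powersetCard.1 hT).1 huT
    · exact h2 (mem_sdiff.2 ⟨hue, by simpa [huT] using huv⟩)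

theorem diracThreshold_filter_neBot {k : ℕ} (hk : 0 < k) :
    (Filter.atTop ⊓ Filter.principal {n : ℕ | k ∣ n}).NeBot := by
  rw [Filter.inf_principal_neBot_iff]
  intro s hs
  obtain ⟨a, ha⟩ := Filter.mem_atTop_sets.1 hs
  exact ⟨k * a, ha _ (Nat.le_mul_of_pos_left _ hk), dvd_mul_right _ _⟩

theorem eventually_diracT_div_choose_le (k l : ℕ) :
    ∀ᶠ n : ℕ in Filter.atTop ⊓ Filter.principal {n | k ∣ n},
      (diracT n k l : ℝ) / (n.choose (k - l)) ≤ 2 := by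
  refine Filter.Eventually.filter_mono inf_le_left ?_
  filter_upwards [Filter.eventually_ge_atTop (k + l)] with n hn
  have h1 : (1 : ℝ) ≤ n.choose (k - l) := by exact_mod_cast Nat.choose_pos (by omega)
  have h2 : (diracT n k l : ℝ) ≤ n.choose (k - l) + 1 := by
    exact_mod_cast diracT_le (by omega)
  rw [div_le_iff₀ (by linarith)]
  linarith

theorem diracThreshold_nonneg {k l : ℕ} (hk : 0 < k) : 0 ≤ diracThreshold k l := by
  have := diracThreshold_filter_neBot hk
  refine Filter.le_limsup_of_le ⟨2, eventually_diracT_div_choose_le k l⟩ fun b hb => ?_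
  obtain ⟨n, hn⟩ := hb.exists
  exact le_trans (by positivity) hn

theorem eventually_diracT_le {k l : ℕ} (hk : 0 < k) {η : ℝ} (hη : 0 < η) :
    ∀ᶠ n : ℕ in Filter.atTop, k ∣ n →
      (diracT n k l : ℝ) ≤ (diracThreshold k l + η) * n.choose (k - l) := by
  have := diracThreshold_filter_neBot hk
  have h := Filter.eventually_lt_of_limsup_lt (lt_add_of_pos_right (diracThreshold k l) hη)
    ⟨2, eventually_diracT_div_choose_le k l⟩
  rw [Filter.eventually_inf_principal] at h
  filter_upwards [h, Filter.eventually_ge_atTop k] with n hn hkn hkd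
  have h1 : (0 : ℝ) < n.choose (k - l) := by exact_mod_cast Nat.choose_pos (by omega)
  exact ((div_lt_iff₀ h1).1 (hn hkd)).le

theorem tendsto_choose_add_div_choose (l r : ℕ) :
    Filter.Tendsto (fun n : ℕ => ((n + l).choose r : ℝ) / n.choose r) Filter.atTop (nhds 1) := by
  have h0 : Asymptotics.IsEquivalent Filter.atTop (fun n : ℕ => ((n + l : ℕ) : ℝ))
      (fun n : ℕ => (n : ℝ)) := by
    refine (Asymptotics.isEquivalent_iff_tendsto_one ?_).2 ?_
    · filter_upwards [Filter.eventually_gt_atTop 0] with n hn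
      positivity
    · have := (tendsto_const_div_atTop_nhds_zero_nat (l : ℝ)).const_add 1
      rw [add_zero] at this
      refine this.congr' ?_
      filter_upwards [Filter.eventually_gt_atTop 0] with n hn
      have : (n : ℝ) ≠ 0 := by positivity
      simp only [Pi.div_apply]
      push_cast
      field_simp
  have h1 := (isEquivalent_choose r).comp_tendsto (Filter.tendsto_add_atTop_nat l)
  have h2 : Asymptotics.IsEquivalent Filter.atTop (fun n : ℕ => ((n + l : ℕ).choose r : ℝ))
      (fun n : ℕ => (n.choose r : ℝ)) := by
    refine h1.trans (Asymptotics.IsEquivalent.trans ?_ (isEquivalent_choose r).symm)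
    exact (h0.pow r).div Asymptotics.IsEquivalent.refl
  refine (Asymptotics.isEquivalent_iff_tendsto_one ?_).1 h2
  filter_upwards [Filter.eventually_ge_atTop r] with n hn
  exact_mod_cast (Nat.choose_pos hn).ne'

theorem eventually_mul_choose_add_le (l r : ℕ) {a b : ℝ} (hab : a < b) :
    ∀ᶠ n : ℕ in Filter.atTop, a * ((n + l).choose r : ℝ) ≤ b * n.choose r := by
  have h := ((tendsto_choose_add_div_choose l r).const_mul a).eventually_lt_const
    (u := b) (by simpa using hab)
  filter_upwards [h, Filter.eventually_ge_atTop r] with n hn hr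
  have h1 : (0 : ℝ) < n.choose r := by exact_mod_cast Nat.choose_pos hr
  rw [← mul_div_assoc, div_lt_iff₀ h1] at hn
  exact hn.le

theorem eventually_choose_mul_exp_le {l r : ℕ} {c γ : ℝ} (hc : 0 < c) (hγ : 0 < γ) :
    ∀ᶠ q : ℕ in Filter.atTop, ((l + q * r).choose l : ℝ) * Real.exp (-(q * c)) ≤ γ := by
  have h1 : Filter.Tendsto (fun q : ℕ => (q : ℝ) * c) Filter.atTop Filter.atTop :=
    tendsto_natCast_atTop_atTop.atTop_mul_const hc
  have h2 := ((Real.tendsto_pow_mul_exp_neg_atTop_nhds_zero l).comp h1).const_mul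
    (((l + r : ℕ) / c) ^ l : ℝ)
  rw [mul_zero] at h2
  filter_upwards [h2.eventually_le_const hγ, Filter.eventually_ge_atTop 1] with q hq hq1
  refine le_trans ?_ hq
  simp only [Function.comp]
  rw [← mul_assoc, ← mul_pow]
  gcongr
  have h3 : ((l + r : ℕ) : ℝ) / c * (q * c) = ((q * (l + r) : ℕ) : ℝ) := by
    push_cast
    field_simp
  rw [h3]
  norm_cast
  refine (Nat.choose_le_pow _ _).trans ?_
  gcongr
  nlinarith

theorem exists_sample_size {k l r : ℕ} (hk : k = l + r) (hr : 0 < r) {η γ : ℝ}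
    (hη : 0 < η) (hγ : 0 < γ) :
    ∃ q m : ℕ, 0 < m ∧ m = l + q * r ∧
      (diracT m k l : ℝ) ≤ (diracThreshold k l + 2 * η) * (q * r).choose r ∧
      (m.choose l : ℝ) * Real.exp (-(q * η ^ 2 / 2)) ≤ γ := by
  have hk0 : 0 < k := by omega
  have hkl : k - l = r := by omega
  have hq : Filter.Tendsto (fun t : ℕ => k * t + 1) Filter.atTop Filter.atTop :=
    Filter.tendsto_atTop_mono (fun t => (Nat.le_mul_of_pos_left t hk0).trans (Nat.le_succ _))
      Filter.tendsto_id
  have hqr : Filter.Tendsto (fun q : ℕ => q * r) Filter.atTop Filter.atTop :=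
    Filter.tendsto_atTop_mono (fun q => Nat.le_mul_of_pos_right q hr) Filter.tendsto_id
  have hm : Filter.Tendsto (fun q : ℕ => l + q * r) Filter.atTop Filter.atTop :=
    Filter.tendsto_atTop_mono (fun q => Nat.le_add_left _ _) hqr
  have h1 := hm.eventually (eventually_diracT_le (l := l) hk0 hη)
  have h2 := hqr.eventually (eventually_mul_choose_add_le l r (a := diracThreshold k l + η)
    (b := diracThreshold k l + 2 * η) (by linarith))
  have h3 := eventually_choose_mul_exp_le (l := l) (r := r) (c := η ^ 2 / 2) (by positivity) hγ
  obtain ⟨t, h1, h2, h3⟩ := (hq.eventually (h1.and (h2.and h3))).exists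
  refine ⟨k * t + 1, _, ?_, rfl, ?_, ?_⟩
  · exact Nat.add_pos_right _ (Nat.mul_pos (Nat.succ_pos _) hr)
  · refine (h1 ⟨r * t + 1, ?_⟩).trans ?_
    · rw [hk]
      ring
    · rw [hkl, add_comm l]
      exact h2
  · rw [mul_div_assoc]
    exact h3

theorem mul_pow_le_descFactorial {n r : ℕ} (hr : r ≤ n) (hn : 0 < n) :
    (1 - (r : ℝ) ^ 2 / n) * (n : ℝ) ^ r ≤ n.descFactorial r := by
  have hn' : (0 : ℝ) < n := by exact_mod_cast hn
  have hr' : (r : ℝ) / n ≤ 1 := (div_le_one hn').2 (by exact_mod_cast hr)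
  have h1 := one_add_mul_le_pow (a := -((r : ℝ) / n)) (by linarith) r
  calc (1 - (r : ℝ) ^ 2 / n) * (n : ℝ) ^ r ≤ (1 + -((r : ℝ) / n)) ^ r * (n : ℝ) ^ r := by
        gcongr
        refine le_trans (le_of_eq ?_) h1
        ring
    _ = ((n - r : ℕ) : ℝ) ^ r := by
        rw [← mul_pow, Nat.cast_sub hr]
        congr 1
        field_simp
        ring
    _ ≤ ((n + 1 - r : ℕ) : ℝ) ^ r := by
        gcongr
        omega
    _ ≤ n.descFactorial r := by exact_mod_cast n.pow_sub_le_descFactorial r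

theorem mul_pow_le_card_tuples_avoiding {V : Type*} [Fintype V] [DecidableEq V] [Nonempty V]
    {H : Finset (Finset V)} {n k l r : ℕ} (hn : Fintype.card V = n) (hk : k = l + r)
    (hr : r ≤ n) (hH : ∀ e ∈ H, #e = k) {U : Finset V} {a d p : ℝ} (hd : 0 ≤ d) (hp : 0 ≤ p)
    (hU : (#U : ℝ) ≤ a * n) (hpd : p + r * a + d * (r ^ 2 / n) ≤ d)
    (hdeg : ∀ S : Finset V, #S = l → d * (n.choose r : ℝ) ≤ #{e ∈ H | S ⊆ e})
    {S : Finset {v // v ∉ U}} (hS : #S = l) :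
    p * (Fintype.card {v // v ∉ U} : ℝ) ^ r ≤
      #{y : Fin r → {v // v ∉ U} | S ∪ univ.image y ∈ avoidingHypergraph H U} := by
  have hn0 : 0 < n := hn ▸ Fintype.card_pos
  have hn' : (0 : ℝ) < n := by exact_mod_cast hn0
  set S' := S.map (Function.Embedding.subtype _) with hS'
  have hcS : #S' = l := by rw [hS', card_map, hS]
  have h1 : (r.factorial : ℝ) * #{e ∈ H | S' ⊆ e} ≤ #{y : Fin r → V | S' ∪ univ.image y ∈ H} := by
    exact_mod_cast factorial_mul_card_le_card_tuples hk hH hcS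
  have h2 : (#{y : Fin r → V | S' ∪ univ.image y ∈ H} : ℝ) ≤
      #{y : Fin r → {v // v ∉ U} | S ∪ univ.image y ∈ avoidingHypergraph H U} +
        r * (#U * (n : ℝ) ^ (r - 1)) := by
    exact_mod_cast hn ▸ card_tuples_le H U r S
  have h3 : d * ((1 - (r : ℝ) ^ 2 / n) * (n : ℝ) ^ r) ≤ r.factorial * #{e ∈ H | S' ⊆ e} := by
    calc d * ((1 - (r : ℝ) ^ 2 / n) * (n : ℝ) ^ r) ≤ d * n.descFactorial r := by
          gcongr
          exact mul_pow_le_descFactorial hr hn0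
      _ = r.factorial * (d * n.choose r) := by
          rw [Nat.descFactorial_eq_factorial_mul_choose]
          push_cast
          ring
      _ ≤ _ := by
          gcongr
          exact hdeg _ hcS
  have h4 : (r : ℝ) * (#U * (n : ℝ) ^ (r - 1)) ≤ r * a * (n : ℝ) ^ r := by
    rcases Nat.eq_zero_or_pos r with rfl | hr0
    · simp
    · have h5 : (n : ℝ) ^ r = n * (n : ℝ) ^ (r - 1) := by
        rw [← pow_succ', Nat.sub_add_cancel hr0]
      rw [h5]
      calc (r : ℝ) * (#U * (n : ℝ) ^ (r - 1)) ≤ r * (a * n * (n : ℝ) ^ (r - 1)) := by gcongr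
        _ = _ := by ring
  have h5 : (Fintype.card {v // v ∉ U} : ℝ) ≤ n := by
    exact_mod_cast hn ▸ Fintype.card_subtype_le _
  have h6 : p * (n : ℝ) ^ r ≤ (d - d * (r ^ 2 / n) - r * a) * (n : ℝ) ^ r := by
    gcongr
    linarith
  calc p * (Fintype.card {v // v ∉ U} : ℝ) ^ r ≤ p * (n : ℝ) ^ r := by gcongr
    _ ≤ _ := by linarith

theorem exists_isSpreadDist_avoiding {V : Type*} [Fintype V] [DecidableEq V]
    {H : Finset (Finset V)}
    {U : Finset V} {N k l r q m : ℕ} [Nonempty {v // v ∉ U}]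
    (hN : Fintype.card {v // v ∉ U} = N)
    (hk : k = l + r) (hH : ∀ e ∈ H, #e = k) (hm0 : 0 < m) (hm : m = l + q * r)
    (hmN : 2 * m ^ 2 ≤ N) {p η γ : ℝ} (hη : 0 ≤ η) (hγ : 0 < γ)
    (hp : ∀ S : Finset {v // v ∉ U}, #S = l → p * (Fintype.card {v // v ∉ U} : ℝ) ^ r ≤
      #{y : Fin r → {v // v ∉ U} | S ∪ univ.image y ∈ avoidingHypergraph H U})
    (hD : (diracT m k l : ℝ) ≤ (p - η) * (q * r).choose r)
    (hexp : (m.choose l : ℝ) * Real.exp (-(q * η ^ 2 / 2)) ≤ γ / 2) :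
    ∃ μ, IsSpreadDist (2 * ((2 * N) * m ^ k * (Real.exp 1 / N) ^ k))
      (fun M : Finset (Finset V) => M ⊆ H ∧ (M : Set (Finset V)).PairwiseDisjoint id ∧
        (∀ e ∈ M, Disjoint e U) ∧ (#((univ \ U) \ M.biUnion id) : ℝ) ≤ m + 2 * γ * N) μ := by
  classical
  have hmN' : m ≤ N := by nlinarith
  have hN0 : 0 < N := by omega
  have hbad : (#{x : Fin m → {v // v ∉ U} | Function.Injective x ∧
      ¬ ∃ M, HyperPM (pullbackHypergraph (avoidingHypergraph H U) k x) M} : ℝ) ≤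
        γ * N.descFactorial m := by
    refine (card_not_hyperPM_le (avoidingHypergraph H U) hk hm hη hp hD).trans ?_
    have h1 := mul_pow_le_descFactorial hmN' hN0
    have h2 : (m : ℝ) ^ 2 / N ≤ 1 / 2 := by
      rw [div_le_div_iff₀ (by exact_mod_cast hN0) two_pos]
      have : (2 * m ^ 2 : ℝ) ≤ N := by exact_mod_cast hmN
      linarith
    rw [hN]
    calc _ ≤ γ / 2 * (N : ℝ) ^ m := by gcongr
      _ = γ * ((1 - 1 / 2) * (N : ℝ) ^ m) := by ring
      _ ≤ γ * ((1 - (m : ℝ) ^ 2 / N) * (N : ℝ) ^ m) := by gcongr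
      _ ≤ _ := by gcongr
  have hH' : ∀ e ∈ avoidingHypergraph H U, #e = k := by
    intro e he
    rw [← hH _ (mem_filter.1 he).2, card_map]
  obtain ⟨μ, hμ⟩ := exists_isSpreadDist_almost_perfect (avoidingHypergraph H U) hN hH' hm0 hmN'
    hγ hbad
  obtain ⟨ν, hν⟩ := hμ.exists_map (by positivity)
    (mapEmbedding (Function.Embedding.subtype fun v => v ∉ U)).toEmbedding
  refine ⟨ν, hν.1, hν.2.1, fun A hA => ?_, hν.2.2.2⟩
  obtain ⟨M, ⟨hMH, hMd, hMc⟩, rfl⟩ := hν.2.2.1 A hA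
  refine ⟨?_, ?_, ?_, ?_⟩
  · intro e he
    obtain ⟨e', he', rfl⟩ := mem_map.1 he
    exact (mem_filter.1 (hMH he')).2
  · rintro _ he _ hf hef
    obtain ⟨e, he', rfl⟩ := mem_map.1 (mem_coe.1 he)
    obtain ⟨f, hf', rfl⟩ := mem_map.1 (mem_coe.1 hf)
    have := hMd he' hf' (fun h => hef (by rw [h]))
    exact (disjoint_map _).2 this
  · intro e he
    obtain ⟨e', he', rfl⟩ := mem_map.1 he
    rw [Finset.disjoint_left]
    intro v hv
    obtain ⟨w, hw, rfl⟩ := mem_map.1 hv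
    exact w.2
  · refine le_trans ?_ hMc
    rw [← card_map (Function.Embedding.subtype fun v => v ∉ U)]
    norm_cast
    refine card_le_card fun v hv => ?_
    simp only [mem_sdiff, mem_univ, true_and, mem_biUnion, mem_map, not_exists, not_and, id] at hv ⊢
    refine ⟨⟨v, hv.1⟩, fun e he hve => ?_, rfl⟩
    exact hv.2 _ ⟨e, he, rfl⟩ (mem_map.2 ⟨_, hve, rfl⟩)

theorem exists_isSpreadDist_covering {V : Type*} [Fintype V] [DecidableEq V]
    {H : Finset (Finset V)} {U : Finset V} {k : ℕ} (hk : 2 ≤ k) (hH : ∀ e ∈ H, #e = k) {q L : ℝ}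
    (hq : 0 < q) (hL : 0 ≤ L) {μ : Finset (Finset V) → ℝ}
    (hμ : IsSpreadDist q (fun M => M ⊆ H ∧ (M : Set (Finset V)).PairwiseDisjoint id ∧
      (∀ e ∈ M, Disjoint e U) ∧ (#((univ \ U) \ M.biUnion id) : ℝ) ≤ L) μ)
    (hav : ∀ v ∉ U, ∀ X ⊆ U, (#X : ℝ) ≤ k * L → q⁻¹ ≤ #{e ∈ H | v ∈ e ∧ e \ {v} ⊆ U \ X}) :
    ∃ ν, IsSpreadDist q (fun M => M ⊆ H ∧ (M : Set (Finset V)).PairwiseDisjoint id ∧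
      univ \ U ⊆ M.biUnion id ∧ (#(M.biUnion id ∩ U) : ℝ) ≤ k * L) ν := by
  refine hμ.exists_union (Fam₂ := fun A => IsCrossingMatching H U ((univ \ U) \ A.biUnion id))
    (fun e => Disjoint e U) ?_ (fun A hA => hA.2.2.1) ?_ ?_ hq.le
  · rintro A ⟨hAH, hAd, hAU, hAL⟩
    refine exists_isSpreadDist_isCrossingMatching (D := ⌊k * L⌋₊) hH hq _ ?_ ?_ ?_
    · exact sdiff_disjoint.mono_left sdiff_subset
    · refine Nat.le_floor ?_
      push_cast
      gcongr
    · intro v hv X hX hXD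
      refine hav v (mem_sdiff.1 (mem_sdiff.1 hv).1).2 X hX ?_
      exact (Nat.le_floor_iff (by positivity)).1 hXD
  · intro A B hB e he hd
    have h1 := hB.2.2.2 e he
    rw [sdiff_eq_self_of_disjoint hd, hH e (hB.1 he)] at h1
    omega
  · rintro A B ⟨hAH, hAd, hAU, hAL⟩ hB
    have hBA : (B.biUnion id) \ U = (univ \ U) \ A.biUnion id := hB.2.2.1
    have hAB : ∀ e ∈ A, ∀ f ∈ B, Disjoint e f := by
      intro e he f hf
      rw [Finset.disjoint_left]
      intro v hve hvf
      have hvU : v ∉ U := Finset.disjoint_left.1 (hAU e he) hve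
      have h1 : v ∈ (B.biUnion id) \ U := mem_sdiff.2 ⟨mem_biUnion.2 ⟨f, hf, hvf⟩, hvU⟩
      rw [hBA] at h1
      exact (mem_sdiff.1 h1).2 (mem_biUnion.2 ⟨e, he, hve⟩)
    refine ⟨union_subset hAH hB.1, ?_, ?_, ?_⟩
    · rw [coe_union]
      exact hAd.union hB.2.1 fun e he f hf _ => hAB e he f hf
    · rw [union_biUnion]
      intro v hv
      by_cases hvA : v ∈ A.biUnion id
      · exact mem_union_left _ hvA
      · have h1 : v ∈ (B.biUnion id) \ U := hBA ▸ mem_sdiff.2 ⟨hv, hvA⟩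
        exact mem_union_right _ (mem_sdiff.1 h1).1
    · have h1 : (A.biUnion id) ∩ U = ∅ :=
        disjoint_iff_inter_eq_empty.1 ((disjoint_biUnion_left _ _ _).2 hAU)
      rw [union_biUnion, union_inter_distrib_right, h1, empty_union]
      calc (#(B.biUnion id ∩ U) : ℝ) ≤ k * #((univ \ U) \ A.biUnion id) := by
            exact_mod_cast hB.card_inter hH
        _ ≤ _ := by gcongr

theorem div_two_pow_div_factorial_le_choose {u a k : ℕ} (ha : a ≤ k) (hu : 2 * k ≤ u) :
    ((u : ℝ) / 2) ^ a / k.factorial ≤ u.choose a := by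
  refine le_trans ?_ (Nat.pow_le_choose a u)
  have h1 : (u : ℝ) / 2 ≤ (u + 1 - a : ℕ) := by
    rw [div_le_iff₀ two_pos]
    exact_mod_cast (by omega : u ≤ (u + 1 - a) * 2)
  gcongr

theorem mul_pow_le_card_crossing {n k l r : ℕ} (hk : k = l + r) (hl : 0 < l)
    {H : Finset (Finset (Fin n))} (hH : ∀ e ∈ H, #e = k) {U : Finset (Fin n)} {d u : ℝ}
    (hd : 0 ≤ d) (hu : 0 ≤ u) (huU : u ≤ #U) (hU : 2 * k ≤ #U)
    (hdeg : ∀ S : Finset (Fin n), #S = l → d * ((#U).choose r : ℝ) ≤ hDegOn H S U)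
    {v : Fin n} (hv : v ∉ U) :
    d * (u / 2) ^ (k - 1) / (k.factorial ^ 2 * 2 ^ k) ≤ #{e ∈ H | v ∈ e ∧ e \ {v} ⊆ U} := by
  have h1 : ((#U).choose (l - 1) : ℝ) * (d * (#U).choose r) ≤
      2 ^ k * #{e ∈ H | v ∈ e ∧ e \ {v} ⊆ U} := by
    calc _ = ∑ T ∈ powersetCard (l - 1) U, d * ((#U).choose r : ℝ) := by
          rw [sum_const, card_powersetCard, nsmul_eq_mul]
      _ ≤ ∑ T ∈ powersetCard (l - 1) U, (hDegOn H (insert v T) U : ℝ) := by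
          refine sum_le_sum fun T hT => hdeg _ ?_
          obtain ⟨hTU, hT⟩ := mem_powersetCard.1 hT
          rw [card_insert_of_notMem fun h => hv (hTU h), hT, Nat.sub_add_cancel hl]
      _ ≤ _ := by exact_mod_cast sum_hDegOn_le hH U v
  have h2 := div_two_pow_div_factorial_le_choose (a := l - 1) (by omega) hU
  have h3 := div_two_pow_div_factorial_le_choose (a := r) (by omega) hU
  rw [div_le_iff₀ (by positivity)]
  have h4 : (k.factorial : ℝ) ≠ 0 := by positivity
  calc d * (u / 2) ^ (k - 1) ≤ d * ((#U : ℝ) / 2) ^ (k - 1) := by gcongr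
    _ = k.factorial ^ 2 * (((#U : ℝ) / 2) ^ (l - 1) / k.factorial *
        (d * (((#U : ℝ) / 2) ^ r / k.factorial))) := by
        rw [show k - 1 = l - 1 + r by omega, pow_add]
        field_simp
    _ ≤ k.factorial ^ 2 * ((#U).choose (l - 1) * (d * (#U).choose r)) := by gcongr
    _ ≤ k.factorial ^ 2 * (2 ^ k * #{e ∈ H | v ∈ e ∧ e \ {v} ⊆ U}) := by gcongr
    _ = _ := by ring

theorem spread_parameter_le {n N k m : ℕ} (hk : 0 < k) (hN0 : 0 < N) (hN : n ≤ 2 * N)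
    (hn : 0 < n) :
    2 * ((2 * N) * m ^ k * (Real.exp 1 / N) ^ k) ≤
      4 * m ^ k * Real.exp 1 ^ k * 2 ^ k / (n : ℝ) ^ (k - 1) := by
  have hN' : (0 : ℝ) < N := by exact_mod_cast hN0
  have hn' : (0 : ℝ) < n := by exact_mod_cast hn
  have hnN : (n : ℝ) ^ (k - 1) ≤ 2 ^ k * N ^ (k - 1) := by
    calc (n : ℝ) ^ (k - 1) ≤ (2 * N) ^ (k - 1) := by
          gcongr
          exact_mod_cast hN
      _ = 2 ^ (k - 1) * N ^ (k - 1) := mul_pow _ _ _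
      _ ≤ 2 ^ k * N ^ (k - 1) := by
          gcongr
          · exact one_le_two
          · exact Nat.sub_le _ _
  have h1 : (N : ℝ) ^ k = N * N ^ (k - 1) := by rw [← pow_succ', Nat.sub_add_cancel hk]
  calc 2 * ((2 * N) * m ^ k * (Real.exp 1 / N) ^ k)
      = 4 * m ^ k * Real.exp 1 ^ k * (1 / (N : ℝ) ^ (k - 1)) := by
        rw [div_pow, h1]
        field_simp
        ring
    _ ≤ 4 * m ^ k * Real.exp 1 ^ k * (2 ^ k / (n : ℝ) ^ (k - 1)) := by
        refine mul_le_mul_of_nonneg_left ?_ (by positivity)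
        rw [div_le_div_iff₀ (by positivity) (by positivity)]
        linarith
    _ = _ := by ring

theorem exists_isSpreadDist_of_size {n k l r q m : ℕ} (hk : k = l + r) (hl : 0 < l) (hr : 0 < r)
    (hm0 : 0 < m) (hm : m = l + q * r) {ε δ c γ C : ℝ} (hε : 0 < ε) (hε' : ε ≤ 1 / 20)
    (hrε : r * ε ≤ 1 / 10) (hδ : 0 ≤ δ) (hγ : 0 < γ)
    (hc : c = (δ + ε / 3) * (ε ^ 2 / 4) ^ (k - 1) / (k.factorial ^ 2 * 2 ^ k))
    (hγc : k * (3 * γ) ≤ c / 2) (hγε : k * (3 * γ) ≤ ε ^ 4 / 2)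
    (hD : (diracT m k l : ℝ) ≤ (δ + 2 * (ε / 18)) * (q * r).choose r)
    (hexp : (m.choose l : ℝ) * Real.exp (-(q * (ε / 18) ^ 2 / 2)) ≤ γ / 2)
    (hC₁ : 20 * (δ + ε / 3) * r ^ 2 / ε ≤ C) (hC₂ : 4 * k / ε ^ 2 ≤ C) (hC₃ : 4 * m ^ 2 ≤ C)
    (hC₄ : m / γ ≤ C) (hC₅ : 4 * m ^ k * Real.exp 1 ^ k * 2 ^ k ≤ C) (hC₆ : 2 / c ≤ C)
    (hC : 1 ≤ C) (hn : C ≤ n) {H : Finset (Finset (Fin n))} (hH : ∀ e ∈ H, #e = k)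
    {U : Finset (Fin n)} (hU : |(#U : ℝ) - ε ^ 2 * n| ≤ ε * (ε ^ 2 * n))
    (hdeg : ∀ S : Finset (Fin n), #S = l → (δ + ε / 3) * (n.choose r : ℝ) ≤ hDeg H S)
    (hdegU : ∀ S : Finset (Fin n), #S = l → (δ + ε / 3) * ((#U).choose r : ℝ) ≤ hDegOn H S U) :
    ∃ μ, IsSpreadDist (C / (n : ℝ) ^ (k - 1)) (fun M => M ⊆ H ∧
      (M : Set (Finset (Fin n))).PairwiseDisjoint id ∧ univ \ U ⊆ M.biUnion id ∧
      (#(M.biUnion id ∩ U) : ℝ) ≤ ε ^ 2 * #U) μ := by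
  have hn' : (0 : ℝ) < n := by linarith
  have hn0 : 0 < n := by exact_mod_cast hn'
  have : Nonempty (Fin n) := ⟨⟨0, hn0⟩⟩
  have hε2 : 0 < ε ^ 2 * n := by positivity
  obtain ⟨hU1, hU2⟩ := abs_le.1 hU
  have hUa : (#U : ℝ) ≤ (1 + ε) * ε ^ 2 * n := by linarith
  have hUb : ε ^ 2 * n / 2 ≤ #U := by
    have : ε * (ε ^ 2 * n) ≤ 1 / 2 * (ε ^ 2 * n) := by
      gcongr
      linarith
    linarith
  have hUn : (#U : ℝ) ≤ n / 2 := by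
    calc (#U : ℝ) ≤ (1 + ε) * ε ^ 2 * n := hUa
      _ ≤ (1 + 1 / 20) * (1 / 20) ^ 2 * n := by gcongr
      _ ≤ n / 2 := by linarith
  have hc0 : 0 < c := hc ▸ by positivity
  have hkk : 4 * k ≤ ε ^ 2 * n := by
    have := (div_le_iff₀ (by positivity)).1 (hC₂.trans hn)
    linarith
  have hkU : 2 * k ≤ #U := by
    have : (2 * k : ℝ) ≤ #U := by linarith
    exact_mod_cast this
  have hkn : k ≤ n := by
    have : #U ≤ n := by simpa using card_le_univ U
    omega
  obtain ⟨N, hN⟩ : ∃ N, Fintype.card {v // v ∉ U} = N := ⟨_, rfl⟩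
  have hNU : N + #U = n := by
    rw [← hN, Fintype.card_subtype_compl, Fintype.card_fin, Fintype.card_coe]
    exact Nat.sub_add_cancel (by simpa using card_le_univ U)
  have hNU' : (N : ℝ) + #U = n := by exact_mod_cast hNU
  have hnN : n ≤ 2 * N := by
    have : (n : ℝ) ≤ 2 * N := by linarith
    exact_mod_cast this
  have hN0 : 0 < N := by omega
  have : Nonempty {v // v ∉ U} := Fintype.card_pos_iff.1 (hN ▸ hN0)
  have hmN : 2 * m ^ 2 ≤ N := by
    have : (2 * m ^ 2 : ℝ) ≤ N := by linarith
    exact_mod_cast this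
  have hp : ∀ S : Finset {v // v ∉ U}, #S = l →
      (δ + ε / 6) * (Fintype.card {v // v ∉ U} : ℝ) ^ r ≤
        #{y : Fin r → {v // v ∉ U} | S ∪ univ.image y ∈ avoidingHypergraph H U} := by
    intro S hS
    have h1 : (δ + ε / 3) * (r ^ 2 / n) ≤ ε / 20 := by
      rw [← mul_div_assoc, div_le_iff₀ hn']
      have := (div_le_iff₀ hε).1 (hC₁.trans hn)
      linarith
    have h2 : r * ((1 + ε) * ε ^ 2) ≤ ε * (11 / 100) := by
      calc r * ((1 + ε) * ε ^ 2) = r * ε * (1 + ε) * ε := by ring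
        _ ≤ 1 / 10 * (1 + 1 / 20) * ε := by gcongr
        _ ≤ _ := by linarith
    exact mul_pow_le_card_tuples_avoiding (Fintype.card_fin n) hk (by omega) hH
      (d := δ + ε / 3) (p := δ + ε / 6) (by positivity) (by positivity) hUa (by linarith) hdeg hS
  obtain ⟨μ, hμ⟩ := exists_isSpreadDist_avoiding hN hk hH hm0 hm hmN (η := ε / 18)
    (by positivity) hγ hp (hD.trans (by gcongr; linarith)) hexp
  have hμ' := hμ.mono (by positivity) ((spread_parameter_le (by omega) hN0 hnN hn0).trans
    (div_le_div_of_nonneg_right hC₅ (by positivity)))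
  have hL : m + 2 * γ * N ≤ 3 * γ * n := by
    have h1 := (div_le_iff₀ hγ).1 (hC₄.trans hn)
    have h2 : γ * N ≤ γ * n := by
      gcongr
      omega
    linarith
  have hav : ∀ v ∉ U, ∀ X ⊆ U, (#X : ℝ) ≤ k * (m + 2 * γ * N) →
      (C / (n : ℝ) ^ (k - 1))⁻¹ ≤ #{e ∈ H | v ∈ e ∧ e \ {v} ⊆ U \ X} := by
    intro v hv X hX hXL
    have h1 := mul_pow_le_card_crossing hk hl hH (by positivity) (by positivity) hUb hkU hdegU hv
    have h2 : (#{e ∈ H | v ∈ e ∧ e \ {v} ⊆ U} : ℝ) ≤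
        #{e ∈ H | v ∈ e ∧ e \ {v} ⊆ U \ X} + #X * (n : ℝ) ^ (k - 2) := by
      have := card_crossing_le hH hv hX
      rw [Fintype.card_fin] at this
      exact_mod_cast this
    have h3 : (δ + ε / 3) * (ε ^ 2 * n / 2 / 2) ^ (k - 1) / (k.factorial ^ 2 * 2 ^ k) =
        c * (n : ℝ) ^ (k - 1) := by
      rw [hc, show ε ^ 2 * n / 2 / 2 = ε ^ 2 / 4 * n by ring, mul_pow]
      ring
    have h4 : #X * (n : ℝ) ^ (k - 2) ≤ c / 2 * (n : ℝ) ^ (k - 1) := by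
      calc #X * (n : ℝ) ^ (k - 2) ≤ k * (3 * γ * n) * (n : ℝ) ^ (k - 2) := by
            gcongr
            exact hXL.trans (by gcongr)
        _ = k * (3 * γ) * (n : ℝ) ^ (k - 1) := by
            rw [show k - 1 = k - 2 + 1 by omega, pow_succ]
            ring
        _ ≤ _ := by gcongr
    have h5 : (C / (n : ℝ) ^ (k - 1))⁻¹ ≤ c / 2 * (n : ℝ) ^ (k - 1) := by
      rw [inv_div, div_le_iff₀ (by linarith)]
      have := (div_le_iff₀ hc0).1 hC₆
      calc (n : ℝ) ^ (k - 1) = 1 * (n : ℝ) ^ (k - 1) := (one_mul _).symm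
        _ ≤ (c / 2 * C) * (n : ℝ) ^ (k - 1) := by
            gcongr
            linarith
        _ = _ := by ring
    linarith
  obtain ⟨ν, hν⟩ := exists_isSpreadDist_covering (by omega) hH (by positivity) (by positivity)
    hμ' hav
  refine ⟨ν, hν.1, hν.2.1, fun M hM => ?_, hν.2.2.2⟩
  obtain ⟨h1, h2, h3, h4⟩ := hν.2.2.1 M hM
  refine ⟨h1, h2, h3, ?_⟩
  calc (#(M.biUnion id ∩ U) : ℝ) ≤ k * (m + 2 * γ * N) := h4
    _ ≤ k * (3 * γ * n) := by gcongr
    _ = k * (3 * γ) * n := by ring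
    _ ≤ ε ^ 4 / 2 * n := by gcongr
    _ = ε ^ 2 * (ε ^ 2 * n / 2) := by ring
    _ ≤ _ := by gcongr

/-- Cover-down lemma: for `1 ≤ ℓ < k` and `0 < ε < 1/(10·k!)` there is `C > 0` such that for
every `k`-uniform hypergraph `𝓗` on at least `C` vertices and every `U ⊆ V(𝓗)` of size
`(1 ± ε)ε²|V(𝓗)|`, if `δ_ℓ(𝓗) ≥ (δ⁺_{ℓ,k} + ε/3)C(|V|,k-ℓ)` and every `ℓ`-set has
`deg(S,U) ≥ (δ⁺_{ℓ,k} + ε/3)C(|U|,k-ℓ)`, then there is a `(C/|V|^{k-1})`-spread distribution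
on matchings covering all of `V ∖ U` and at most `ε²|U|` vertices of `U`. -/
theorem statement10 :
    ∀ k l : ℕ, 1 ≤ l → l < k → ∀ ε : ℝ, 0 < ε → ε < 1 / (10 * (Nat.factorial k : ℝ)) →
    ∃ C : ℝ, 0 < C ∧ ∀ n : ℕ, C ≤ (n : ℝ) →
    ∀ H : Finset (Finset (Fin n)), (∀ e ∈ H, e.card = k) →
    ∀ U : Finset (Fin n),
    |(U.card : ℝ) - ε ^ 2 * n| ≤ ε * (ε ^ 2 * n) →
    (∀ S : Finset (Fin n), S.card = l →
      (diracThreshold k l + ε / 3) * (n.choose (k - l) : ℝ) ≤ (hDeg H S : ℝ)) →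
    (∀ S : Finset (Fin n), S.card = l →
      (diracThreshold k l + ε / 3) * ((U.card.choose (k - l)) : ℝ) ≤ (hDegOn H S U : ℝ)) →
    ∃ μ : Finset (Finset (Fin n)) → ℝ,
      IsSpreadDist (C / (n : ℝ) ^ (k - 1))
        (fun M => M ⊆ H ∧ (M : Set (Finset (Fin n))).PairwiseDisjoint id ∧
          Finset.univ \ U ⊆ M.biUnion id ∧
          (((M.biUnion id) ∩ U).card : ℝ) ≤ ε ^ 2 * U.card) μ := by
  intro k l hl hlk ε hε hεk
  obtain ⟨r, hk⟩ : ∃ r, k = l + r := ⟨k - l, by omega⟩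
  have hr : 0 < r := by omega
  have hkr : k - l = r := by omega
  have hδ := diracThreshold_nonneg (l := l) (by omega : 0 < k)
  have hkf : (2 : ℝ) ≤ k.factorial := by
    exact_mod_cast (by omega : 2 ≤ k).trans k.self_le_factorial
  have hrf : (r : ℝ) ≤ k.factorial := by
    exact_mod_cast (by omega : r ≤ k).trans k.self_le_factorial
  have hεf : k.factorial * ε ≤ 1 / 10 := by
    rw [lt_div_iff₀ (by positivity)] at hεk
    linarith
  obtain ⟨c, hc⟩ : ∃ c : ℝ, c = (diracThreshold k l + ε / 3) * (ε ^ 2 / 4) ^ (k - 1) /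
    (k.factorial ^ 2 * 2 ^ k) := ⟨_, rfl⟩
  have hc0 : 0 < c := hc ▸ by positivity
  have hk0 : (0 : ℝ) < k := by exact_mod_cast (by omega : 0 < k)
  obtain ⟨γ, hγ⟩ : ∃ γ : ℝ, γ = min c (ε ^ 4) / (6 * k) := ⟨_, rfl⟩
  have hγ0 : 0 < γ := hγ ▸ div_pos (lt_min hc0 (by positivity)) (by positivity)
  have hγk : k * (3 * γ) = min c (ε ^ 4) / 2 := by
    rw [hγ]
    field_simp
    norm_num
  obtain ⟨q, m, hm0, hm, hD, hexp⟩ := exists_sample_size hk hr (η := ε / 18) (γ := γ / 2)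
    (by positivity) (by positivity)
  have h₁ : 0 ≤ 20 * (diracThreshold k l + ε / 3) * r ^ 2 / ε := by positivity
  have h₂ : 0 ≤ 4 * k / ε ^ 2 := by positivity
  have h₃ : (0 : ℝ) ≤ 4 * m ^ 2 := by positivity
  have h₄ : 0 ≤ m / γ := by positivity
  have h₅ : 0 ≤ 4 * m ^ k * Real.exp 1 ^ k * 2 ^ k := by positivity
  have h₆ : 0 ≤ 2 / c := by positivity
  refine ⟨20 * (diracThreshold k l + ε / 3) * r ^ 2 / ε + 4 * k / ε ^ 2 + 4 * m ^ 2 + m / γ +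
    4 * m ^ k * Real.exp 1 ^ k * 2 ^ k + 2 / c + 1, by linarith, ?_⟩
  intro n hn H hH U hU hdeg hdegU
  rw [hkr] at hdeg hdegU
  refine exists_isSpreadDist_of_size hk hl hr hm0 hm hε ?_ ?_ hδ hγ0 hc ?_ ?_ hD hexp
    ?_ ?_ ?_ ?_ ?_ ?_ ?_ hn hH hU hdeg hdegU
  · linarith [(mul_le_mul_of_nonneg_right hkf hε.le).trans hεf]
  · exact (mul_le_mul_of_nonneg_right hrf hε.le).trans hεf
  · rw [hγk]
    linarith [min_le_left c (ε ^ 4)]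
  · rw [hγk]
    linarith [min_le_right c (ε ^ 4)]
  all_goals linarith
end

section
/- Let d > 0. There exist δ₀ = δ₀(d) > 0, a constant C = C(d) > 0, and n₀ such that the following holds for all 0 < δ ≤ δ₀ and n ≥ n₀. If G is a (d,δ)-super-regular bipartite graph with parts of size n, then there exists a (C/n)-spread probability distribution on the set of perfect matchings of G, where the ground set is the edge set E(G). -/
open Finset

variable {V : Type*} [Fintype V] [DecidableEq V]

/-- The number of neighbours of `v` in the set `B`. -/
def nbrCount (G : SimpleGraph V) [DecidableRel G.Adj] (v : V) (B : Finset V) : ℕ :=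
  (B.filter (fun w => G.Adj v w)).card

/-- The edge density `d_G(A,B) = e_G(A,B)/(|A||B|)` between the vertex sets `A` and `B`. -/
noncomputable def pairDensity (G : SimpleGraph V) [DecidableRel G.Adj] (A B : Finset V) : ℝ :=
  (∑ v ∈ A, (nbrCount G v B : ℝ)) / ((A.card : ℝ) * (B.card : ℝ))

/-- The pair `(A,B)` is `(d,ε)`-regular in `G`: it has density `d`, and all pairs of subsets
`X ⊆ A`, `Y ⊆ B` with `|X| ≥ ε|A|`, `|Y| ≥ ε|B|` have density within `ε` of `d`. -/
def IsRegularPair (G : SimpleGraph V) [DecidableRel G.Adj] (A B : Finset V) (d ε : ℝ) : Prop :=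
  pairDensity G A B = d ∧
    ∀ X ⊆ A, ∀ Y ⊆ B, ε * A.card ≤ X.card → ε * B.card ≤ Y.card →
      |pairDensity G X Y - d| ≤ ε

/-- The pair `(A,B)` is `(d,ε,δ')`-super-regular in `G`: it is `(d,ε)`-regular and every vertex
of one side has at least `δ'` times the size of the other side many neighbours there. -/
def IsSuperRegular3 (G : SimpleGraph V) [DecidableRel G.Adj] (A B : Finset V)
    (d ε δ' : ℝ) : Prop :=
  IsRegularPair G A B d ε ∧
    (∀ v ∈ A, δ' * B.card ≤ (nbrCount G v B : ℝ)) ∧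
    (∀ v ∈ B, δ' * A.card ≤ (nbrCount G v A : ℝ))

/-- `(d,ε)`-super-regular means `(d,ε,d-ε)`-super-regular. -/
def IsSuperRegular (G : SimpleGraph V) [DecidableRel G.Adj] (A B : Finset V) (d ε : ℝ) : Prop :=
  IsSuperRegular3 G A B d ε (d - ε)

/-- `M` is (the edge set of) a perfect matching of `G'`: a set of edges of `G'` such that every
vertex lies in exactly one of them. -/
def IsPMEdgeSet {V : Type*} (G' : SimpleGraph V) (M : Finset (Sym2 V)) : Prop :=
  (↑M : Set (Sym2 V)) ⊆ G'.edgeSet ∧ ∀ v : V, ∃! e, e ∈ M ∧ v ∈ e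


/-- Precompose the bijection `σ` with the 3-cycle `u ↦ x ↦ z ↦ u`. -/
def rotateEquiv {α β : Type*} [DecidableEq α] (σ : α ≃ β) (u x z : α) : α ≃ β :=
  (Equiv.swap u x * Equiv.swap x z).trans σ

section RotateEquiv

variable {α β : Type*} [DecidableEq α]

lemma rotateEquiv_fst (σ : α ≃ β) {u x z : α} (hx : x ≠ u) (hz : z ≠ u) :
    rotateEquiv σ u x z u = σ x := by
  simp [rotateEquiv, Equiv.swap_apply_of_ne_of_ne hx.symm hz.symm]

lemma rotateEquiv_snd (σ : α ≃ β) {u x z : α} (hz : z ≠ u) (hxz : x ≠ z) :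
    rotateEquiv σ u x z x = σ z := by
  simp [rotateEquiv, Equiv.swap_apply_of_ne_of_ne hz hxz.symm]

lemma rotateEquiv_thd (σ : α ≃ β) (u x z : α) : rotateEquiv σ u x z z = σ u := by
  simp [rotateEquiv]

lemma rotateEquiv_of_ne (σ : α ≃ β) {u x z a : α} (hu : a ≠ u) (hx : a ≠ x) (hz : a ≠ z) :
    rotateEquiv σ u x z a = σ a := by
  simp [rotateEquiv, Equiv.swap_apply_of_ne_of_ne hx hz, Equiv.swap_apply_of_ne_of_ne hu hx]

lemma rotateEquiv_injective (u x z : α) :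
    Function.Injective (fun σ : α ≃ β => rotateEquiv σ u x z) := by
  intro σ τ h
  ext a
  have := DFunLike.congr_fun h ((Equiv.swap u x * Equiv.swap x z).symm a)
  simpa only [rotateEquiv, Equiv.trans_apply, Equiv.apply_symm_apply] using this

end RotateEquiv

section Switching

variable {α β : Type*} [Fintype α] [DecidableEq α]

/-- The points at which the bijection `σ` does not follow the relation `R`. -/
def badPoints (R : α → β → Prop) [DecidableRel R] (σ : α ≃ β) : Finset α :=
  univ.filter (fun a => ¬ R a (σ a))

/-- The pairs `(x, z)` avoiding `F` for which rotating `σ` along `u, x, z` creates pairs in `R`. -/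
def switchPairs (R : α → β → Prop) [DecidableRel R] (σ : α ≃ β) (u : α) (F : Finset α) :
    Finset (α × α) :=
  univ.filter (fun p => p.1 ∉ F ∧ p.2 ∉ F ∧ p.1 ≠ p.2 ∧
    R u (σ p.1) ∧ R p.1 (σ p.2) ∧ R p.2 (σ u))

/-- Around every point, avoiding few other points, there are at least `c n²` switches. -/
def ManySwitches (R : α → β → Prop) [DecidableRel R] (c γ : ℝ) : Prop :=
  ∀ (σ : α ≃ β) (u : α) (F : Finset α), u ∈ F → (F.card : ℝ) ≤ γ * Fintype.card α →
    c * (Fintype.card α : ℝ) ^ 2 ≤ ((switchPairs R σ u F).card : ℝ)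

variable {R : α → β → Prop} [DecidableRel R] {c γ : ℝ}

lemma badPoints_rotateEquiv_subset {σ : α ≃ β} {u : α} {p : α × α}
    (hp : p ∈ switchPairs R σ u {u}) :
    badPoints R (rotateEquiv σ u p.1 p.2) ⊆ (badPoints R σ).erase u := by
  obtain ⟨x, z⟩ := p
  simp only [switchPairs, mem_filter, mem_univ, true_and, mem_singleton] at hp
  obtain ⟨hx, hz, hxz, h1, h2, h3⟩ := hp
  intro a ha
  simp only [badPoints, mem_filter, mem_univ, true_and, mem_erase] at ha ⊢
  by_cases hau : a = u
  · subst hau; rw [rotateEquiv_fst σ hx hz] at ha; exact absurd h1 ha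
  by_cases hax : a = x
  · subst hax; rw [rotateEquiv_snd σ hz hxz] at ha; exact absurd h2 ha
  by_cases haz : a = z
  · subst haz; rw [rotateEquiv_thd] at ha; exact absurd h3 ha
  · rw [rotateEquiv_of_ne σ hau hax haz] at ha
    exact ⟨hau, ha⟩

variable [Fintype β] [DecidableEq β]

/-- The bijections following `R` and containing all pairs of `P`. -/
def extendingMatchings (R : α → β → Prop) [DecidableRel R] (P : Finset (α × β)) :
    Finset (α ≃ β) :=
  univ.filter (fun σ => (∀ a, R a (σ a)) ∧ ∀ p ∈ P, σ p.1 = p.2)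

lemma card_exact_bad_le (hR : ManySwitches R c γ) (hn : 1 ≤ γ * Fintype.card α) (t : ℕ) :
    ((univ.filter (fun σ : α ≃ β => (badPoints R σ).card = t + 1)).card : ℝ) *
        ((t + 1 : ℝ) * (c * (Fintype.card α : ℝ) ^ 2)) ≤
      (univ.filter (fun σ : α ≃ β => (badPoints R σ).card ≤ t)).card *
        (Fintype.card α : ℝ) ^ 3 := by
  set B := univ.filter (fun σ : α ≃ β => (badPoints R σ).card = t + 1) with hB
  set T : Finset (Σ _ : α ≃ β, Σ _ : α, α × α) :=
    B.sigma (fun σ => (badPoints R σ).sigma (fun u => switchPairs R σ u {u})) with hT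
  have hlow : (B.card : ℝ) * ((t + 1 : ℝ) * (c * (Fintype.card α : ℝ) ^ 2)) ≤ T.card := by
    rw [hT, card_sigma, Nat.cast_sum, ← nsmul_eq_mul]
    refine card_nsmul_le_sum _ _ _ fun σ hσ => ?_
    have hσ' : (badPoints R σ).card = t + 1 := by simpa [hB] using hσ
    rw [card_sigma, Nat.cast_sum]
    have : ((t + 1 : ℝ) * (c * (Fintype.card α : ℝ) ^ 2)) =
        (badPoints R σ).card • (c * (Fintype.card α : ℝ) ^ 2) := by
      rw [hσ', nsmul_eq_mul]; push_cast; ring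
    rw [this]
    exact card_nsmul_le_sum _ _ _ fun u _ => hR σ u {u} (by simp) (by simpa using hn)
  have hup : T.card ≤ ((univ.filter (fun σ : α ≃ β => (badPoints R σ).card ≤ t)) ×ˢ
      (univ : Finset (α × α × α))).card := by
    refine card_le_card_of_injOn
      (fun q => (rotateEquiv q.1 q.2.1 q.2.2.1 q.2.2.2, (q.2.1, q.2.2.1, q.2.2.2))) ?_ ?_
    · rintro ⟨σ, u, p⟩ hq
      simp only [hT, hB, mem_coe, mem_sigma, mem_filter, mem_univ, true_and] at hq
      obtain ⟨h1, h2, h3⟩ := hq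
      simp only [coe_product, Set.mem_prod, mem_coe, mem_filter, mem_univ, true_and, and_true]
      have := card_le_card (badPoints_rotateEquiv_subset h3)
      rw [card_erase_of_mem h2, h1] at this
      simpa using this
    · rintro ⟨σ, u, x, z⟩ _ ⟨σ', u', x', z'⟩ _ h
      simp only [Prod.mk.injEq] at h
      obtain ⟨h, rfl, rfl, rfl⟩ := h
      obtain rfl := rotateEquiv_injective _ _ _ h
      rfl
  refine hlow.trans ?_
  have h' : (T.card : ℝ) ≤ _ := Nat.cast_le.2 hup
  refine h'.trans (le_of_eq ?_)
  simp only [card_product, card_univ, Fintype.card_prod]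
  push_cast
  ring

lemma factorial_mul_card_le (hR : ManySwitches R c γ) (hc : 0 < c)
    (hn : 1 ≤ γ * Fintype.card α) (t : ℕ) (ht : t ≤ Fintype.card α) :
    (t.factorial : ℝ) * (univ.filter (fun σ : α ≃ β => (badPoints R σ).card ≤ t)).card ≤
      ((1 + 1 / c) * Fintype.card α) ^ t * (extendingMatchings R (∅ : Finset (α × β))).card := by
  induction t with
  | zero => simp [extendingMatchings, badPoints, filter_eq_empty_iff]
  | succ t ih =>
    specialize ih (by omega)
    set n : ℝ := ((Fintype.card α : ℕ) : ℝ) with hndef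
    have hnpos : 0 < n := by
      rw [hndef]; exact Nat.cast_pos.2 (by omega)
    have htn : (t + 1 : ℝ) ≤ n := by rw [hndef]; exact_mod_cast ht
    have key := card_exact_bad_le (R := R) (β := β) hR hn t
    rw [← hndef] at key
    have hsplit : ((univ.filter (fun σ : α ≃ β => (badPoints R σ).card ≤ t + 1)).card : ℝ) ≤
        (univ.filter (fun σ : α ≃ β => (badPoints R σ).card ≤ t)).card +
        (univ.filter (fun σ : α ≃ β => (badPoints R σ).card = t + 1)).card := by
      rw [← Nat.cast_add, Nat.cast_le]
      refine le_trans (card_le_card ?_) (card_union_le _ _)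
      intro σ
      simp only [mem_filter, mem_univ, true_and, mem_union]
      omega
    set g : ℝ := ((univ.filter (fun σ : α ≃ β => (badPoints R σ).card ≤ t)).card : ℝ) with hg
    set b : ℝ := ((univ.filter (fun σ : α ≃ β => (badPoints R σ).card = t + 1)).card : ℝ) with hb
    have hg0 : 0 ≤ g := Nat.cast_nonneg _
    have hb' : (t + 1) * b ≤ 1 / c * n * g := by
      have h1 : n ^ 2 * ((t + 1) * b * c) ≤ n ^ 2 * (n * g) := by nlinarith
      have h2 := le_of_mul_le_mul_left h1 (by positivity)
      rw [one_div, mul_assoc, ← div_eq_inv_mul, le_div_iff₀ hc]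
      exact h2
    have hstep : (t + 1 : ℝ) *
        (univ.filter (fun σ : α ≃ β => (badPoints R σ).card ≤ t + 1)).card ≤
        (1 + 1 / c) * n * g := by
      have h3 : (t + 1 : ℝ) * g ≤ n * g := mul_le_mul_of_nonneg_right htn hg0
      have h4 := mul_le_mul_of_nonneg_left hsplit (by positivity : (0 : ℝ) ≤ t + 1)
      linarith
    rw [Nat.factorial_succ, Nat.cast_mul, pow_succ]
    push_cast
    have h5 := mul_le_mul_of_nonneg_left hstep (Nat.cast_nonneg t.factorial : (0 : ℝ) ≤ _)
    have h6 := mul_le_mul_of_nonneg_left ih (by positivity : (0 : ℝ) ≤ (1 + 1 / c) * n)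
    linarith

lemma factorial_sq_le (hR : ManySwitches R c γ) (hc : 0 < c)
    (hn : 1 ≤ γ * Fintype.card α) (hcard : Fintype.card α = Fintype.card β) :
    ((Fintype.card α).factorial : ℝ) ^ 2 ≤ ((1 + 1 / c) * Fintype.card α) ^ Fintype.card α *
      (extendingMatchings R (∅ : Finset (α × β))).card := by
  have h := factorial_mul_card_le (R := R) (β := β) hR hc hn _ le_rfl
  have h2 : (univ.filter (fun σ : α ≃ β => (badPoints R σ).card ≤ Fintype.card α)) = univ :=
    filter_true_of_mem fun σ _ => card_le_univ _
  rw [h2, card_univ, Fintype.card_equiv (Fintype.equivOfCardEq hcard)] at h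
  rwa [sq]

lemma fst_injOn_of_mem_extendingMatchings {P : Finset (α × β)} {σ : α ≃ β}
    (hσ : σ ∈ extendingMatchings R P) : Set.InjOn Prod.fst (P : Set (α × β)) := by
  simp only [extendingMatchings, mem_filter, mem_univ, true_and] at hσ
  intro p hp q hq h
  exact Prod.ext h (by rw [← hσ.2 p hp, ← hσ.2 q hq, h])

lemma card_extendingMatchings_erase (hR : ManySwitches R c γ) {P : Finset (α × β)}
    (hP : (P.card : ℝ) ≤ γ * Fintype.card α) (hpos : 0 < Fintype.card α)
    {e : α × β} (he : e ∈ P) :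
    ((extendingMatchings R P).card : ℝ) * (c * Fintype.card α) ≤
      (extendingMatchings R (P.erase e)).card := by
  obtain ⟨u, v⟩ := e
  set F : Finset α := P.image Prod.fst with hF
  have huF : u ∈ F := mem_image.2 ⟨_, he, rfl⟩
  set T : Finset (Σ _ : α ≃ β, α × α) :=
    (extendingMatchings R P).sigma (fun σ => switchPairs R σ u F) with hT
  have hlow : ((extendingMatchings R P).card : ℝ) * (c * (Fintype.card α : ℝ) ^ 2) ≤ T.card := by
    rw [hT, card_sigma, Nat.cast_sum, ← nsmul_eq_mul]
    refine card_nsmul_le_sum _ _ _ fun σ _ => hR σ u F huF (le_trans ?_ hP)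
    exact_mod_cast card_image_le
  have hup : T.card ≤ ((extendingMatchings R (P.erase (u, v))) ×ˢ (univ : Finset α)).card := by
    refine card_le_card_of_injOn (fun q => (rotateEquiv q.1 u q.2.1 q.2.2, q.2.1)) ?_ ?_
    · rintro ⟨σ, x, z⟩ hq
      simp only [hT, mem_coe, mem_sigma, extendingMatchings, switchPairs, mem_filter, mem_univ,
        true_and] at hq
      obtain ⟨⟨hσ, hσP⟩, hxF, hzF, hxz, h1, h2, h3⟩ := hq
      have hx : x ≠ u := fun h => hxF (h ▸ huF)
      have hz : z ≠ u := fun h => hzF (h ▸ huF)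
      simp only [coe_product, Set.mem_prod, mem_coe, extendingMatchings, mem_filter, mem_univ,
        true_and, and_true]
      refine ⟨fun a => ?_, fun p hp => ?_⟩
      · by_cases hau : a = u
        · subst hau; rwa [rotateEquiv_fst σ hx hz]
        by_cases hax : a = x
        · subst hax; rwa [rotateEquiv_snd σ hz hxz]
        by_cases haz : a = z
        · subst haz; rwa [rotateEquiv_thd]
        · rw [rotateEquiv_of_ne σ hau hax haz]; exact hσ a
      · obtain ⟨hne, hpP⟩ := mem_erase.1 hp
        have hpF : p.1 ∈ F := mem_image.2 ⟨p, hpP, rfl⟩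
        rw [rotateEquiv_of_ne σ _ (fun h : p.1 = x => hxF (h ▸ hpF)) (fun h : p.1 = z => hzF (h ▸ hpF))]
        · exact hσP p hpP
        · intro h
          refine hne (Prod.ext h ?_)
          rw [← hσP p hpP, h]
          exact hσP _ he
    · rintro ⟨σ, x, z⟩ hq ⟨σ', x', z'⟩ hq' h
      simp only [hT, mem_coe, mem_sigma, extendingMatchings, mem_filter, mem_univ,
        true_and] at hq hq'
      simp only [Prod.mk.injEq] at h
      obtain ⟨h, rfl⟩ := h
      have hz : z = z' := by
        apply (rotateEquiv σ u x z).injective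
        rw [rotateEquiv_thd, h, rotateEquiv_thd, hq.1.2 _ he, hq'.1.2 _ he]
      subst hz
      obtain rfl := rotateEquiv_injective _ _ _ h
      rfl
  have h' : (T.card : ℝ) ≤ _ := Nat.cast_le.2 hup
  rw [card_product, card_univ, Nat.cast_mul] at h'
  have hpos' : (0 : ℝ) < Fintype.card α := by exact_mod_cast hpos
  refine le_of_mul_le_mul_right ?_ hpos'
  linarith

lemma card_extendingMatchings_of_card_le (hR : ManySwitches R c γ) (hc : 0 < c)
    (hpos : 0 < Fintype.card α) (P : Finset (α × β))
    (hP : (P.card : ℝ) ≤ γ * Fintype.card α) :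
    ((extendingMatchings R P).card : ℝ) * (c * Fintype.card α) ^ P.card ≤
      (extendingMatchings R (∅ : Finset (α × β))).card := by
  induction P using Finset.induction_on with
  | empty => simp
  | insert e P he ih =>
    have hle : (P.card : ℝ) ≤ (insert e P).card :=
      Nat.cast_le.2 (card_le_card (subset_insert e P))
    have h := card_extendingMatchings_erase hR hP hpos (mem_insert_self e P)
    rw [erase_insert he] at h
    rw [card_insert_of_notMem he, pow_succ']
    have hpos' : (0 : ℝ) < Fintype.card α := by exact_mod_cast hpos
    have h2 := mul_le_mul_of_nonneg_right h (by positivity : 0 ≤ (c * Fintype.card α) ^ P.card)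
    have h3 := ih (hle.trans hP)
    linarith

lemma card_extendingMatchings_mul_pow_le (hcard : Fintype.card α = Fintype.card β)
    (P : Finset (α × β)) :
    (extendingMatchings R P).card * Fintype.card α ^ P.card ≤
      Fintype.card α ^ Fintype.card α := by
  rcases (extendingMatchings R P).eq_empty_or_nonempty with h | ⟨σ₀, hσ₀⟩
  · simp [h]
  set F : Finset α := P.image Prod.fst with hF
  have hFcard : F.card = P.card := card_image_of_injOn (fst_injOn_of_mem_extendingMatchings hσ₀)
  have hinj : (extendingMatchings R P).card ≤
      (univ : Finset ({a // a ∉ F} → β)).card := by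
    refine card_le_card_of_injOn (fun σ a => σ a.1) (fun _ _ => mem_coe.2 (mem_univ _)) ?_
    intro σ hσ τ hτ h
    simp only [extendingMatchings, coe_filter, mem_univ, true_and, Set.mem_ofPred_eq] at hσ hτ
    ext a
    by_cases ha : a ∈ F
    · obtain ⟨p, hp, rfl⟩ := mem_image.1 ha
      rw [hσ.2 p hp, hτ.2 p hp]
    · exact congrFun h ⟨a, ha⟩
  have hsub : Fintype.card {a // a ∉ F} = Fintype.card α - P.card := by
    rw [Fintype.card_subtype_compl, Fintype.card_coe, hFcard]
  rw [card_univ, Fintype.card_fun, hsub, ← hcard] at hinj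
  calc _ ≤ Fintype.card α ^ (Fintype.card α - P.card) * Fintype.card α ^ P.card :=
        Nat.mul_le_mul_right _ hinj
    _ = _ := by
        rw [← pow_add, Nat.sub_add_cancel]
        rw [← hFcard]; exact card_le_univ F

/-- If switches are abundant, a uniformly random bijection following `R` is spread. -/
lemma card_extendingMatchings_le (hR : ManySwitches R c γ) (hc : 0 < c)
    (hn : 1 ≤ γ * Fintype.card α) (hcard : Fintype.card α = Fintype.card β)
    {m : ℕ} (hm : 1 ≤ m * γ) (hm1 : 1 ≤ m) (P : Finset (α × β)) :
    ((extendingMatchings R P).card : ℝ) ≤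
      (((1 + 1 / c) * Real.exp 2) ^ m / Fintype.card α) ^ P.card *
        (extendingMatchings R (∅ : Finset (α × β))).card := by
  have hpos : 0 < Fintype.card α := by
    rcases Nat.eq_zero_or_pos (Fintype.card α) with h | h
    · rw [h] at hn; norm_num at hn
    · exact h
  set n : ℕ := Fintype.card α with hndef
  have hpos' : (0 : ℝ) < n := by exact_mod_cast hpos
  set L : ℝ := (1 + 1 / c) * Real.exp 2 with hL
  have hc' : 0 < 1 / c := by positivity
  have hexp : 1 ≤ Real.exp 2 := Real.one_le_exp (by norm_num)
  have hLc : 1 / c ≤ L := by nlinarith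
  have hL1 : 1 ≤ L := by nlinarith
  set N : ℝ := ((extendingMatchings R (∅ : Finset (α × β))).card : ℝ) with hN
  have hN0 : 0 ≤ N := Nat.cast_nonneg _
  rw [div_pow, div_mul_eq_mul_div, le_div_iff₀ (by positivity)]
  rcases le_total (P.card : ℝ) (γ * n) with hk | hk
  · have h := card_extendingMatchings_of_card_le hR hc hpos P hk
    rw [← hndef, mul_pow] at h
    have h2 : (1 / c) ^ P.card ≤ (L ^ m) ^ P.card :=
      pow_le_pow_left₀ hc'.le (hLc.trans (le_self_pow₀ hL1 (by omega))) _
    have h3 : (1 / c) ^ P.card * c ^ P.card = 1 := by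
      rw [← mul_pow, one_div_mul_cancel hc.ne', one_pow]
    calc _ = (1 / c) ^ P.card *
          ((extendingMatchings R P).card * (c ^ P.card * (n : ℝ) ^ P.card)) := by
          linear_combination (-((extendingMatchings R P).card * (n : ℝ) ^ P.card)) * h3
      _ ≤ (1 / c) ^ P.card * N := mul_le_mul_of_nonneg_left h (by positivity)
      _ ≤ _ := mul_le_mul_of_nonneg_right h2 hN0
  · have h1 : ((extendingMatchings R P).card : ℝ) * (n : ℝ) ^ P.card ≤ (n : ℝ) ^ n := by
      exact_mod_cast card_extendingMatchings_mul_pow_le hcard P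
    have h2 := factorial_sq_le hR hc hn hcard
    rw [← hndef, mul_pow] at h2
    have hkn : n ≤ m * P.card := by
      have : (n : ℝ) ≤ m * P.card := by
        have h3 := mul_le_mul_of_nonneg_left hk (Nat.cast_nonneg m : (0 : ℝ) ≤ m)
        have h4 := mul_le_mul_of_nonneg_right hm hpos'.le
        linarith
      exact_mod_cast this
    have h3 : L ^ n ≤ (L ^ m) ^ P.card := by
      rw [← pow_mul]; exact pow_le_pow_right₀ hL1 hkn
    have h4 : (n : ℝ) ^ n ≤ Real.exp n * n.factorial := by
      have := Real.pow_div_factorial_le_exp (n : ℝ) hpos'.le n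
      rwa [div_le_iff₀ (by positivity)] at this
    have h5 : L ^ n = (1 + 1 / c) ^ n * Real.exp n ^ 2 := by
      rw [hL, mul_pow, ← Real.exp_nat_mul, ← Real.exp_nat_mul]
      congr 2; push_cast; ring
    refine h1.trans (le_trans ?_ (mul_le_mul_of_nonneg_right h3 hN0))
    refine le_of_mul_le_mul_left ?_ (by positivity : (0 : ℝ) < (n : ℝ) ^ n)
    calc (n : ℝ) ^ n * (n : ℝ) ^ n ≤ (Real.exp n * n.factorial) * (Real.exp n * n.factorial) :=
          mul_le_mul h4 h4 (by positivity) (by positivity)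
      _ = Real.exp n ^ 2 * (n.factorial : ℝ) ^ 2 := by ring
      _ ≤ Real.exp n ^ 2 * ((1 + 1 / c) ^ n * (n : ℝ) ^ n * N) :=
          mul_le_mul_of_nonneg_left h2 (by positivity)
      _ = _ := by rw [h5]; ring

lemma card_matchings_pos (hR : ManySwitches R c γ) (hc : 0 < c)
    (hn : 1 ≤ γ * Fintype.card α) (hcard : Fintype.card α = Fintype.card β) :
    0 < (extendingMatchings R (∅ : Finset (α × β))).card := by
  rw [Nat.pos_iff_ne_zero]
  intro h
  have h2 := factorial_sq_le hR hc hn hcard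
  rw [h, Nat.cast_zero, mul_zero] at h2
  have : (0 : ℝ) < ((Fintype.card α).factorial : ℝ) ^ 2 := by positivity
  linarith

end Switching

section Graph

set_option linter.unusedSectionVars false

/-- Adjacency in `G` between a vertex of `A` and a vertex of `B`. -/
def crossAdj (G : SimpleGraph V) (A B : Finset V) (a : A) (b : B) : Prop := G.Adj a b

instance (G : SimpleGraph V) [DecidableRel G.Adj] (A B : Finset V) :
    DecidableRel (crossAdj G A B) :=
  fun a b => inferInstanceAs (Decidable (G.Adj a b))

/-- The set of edges joining every `a` to `σ a`. -/
def matchingEdges {A B : Finset V} (σ : A ≃ B) : Finset (Sym2 V) :=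
  univ.image (fun a : A => s((a : V), (σ a : V)))

variable {G : SimpleGraph V} [DecidableRel G.Adj] {A B : Finset V} {d ε : ℝ}

lemma card_filter_adj_apply (σ : A ≃ B) (u : V) :
    (univ.filter (fun x : A => G.Adj u (σ x))).card = nbrCount G u B := by
  refine card_bij (fun x _ => (σ x : V)) ?_ ?_ ?_
  · intro x hx
    simpa using hx
  · intro x _ y _ h
    exact σ.injective (Subtype.ext h)
  · intro b hb
    obtain ⟨hbB, hb⟩ := mem_filter.1 hb
    exact ⟨σ.symm ⟨b, hbB⟩, by simpa using hb, by simp⟩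

lemma card_filter_adj (u : V) :
    (univ.filter (fun x : A => G.Adj x u)).card = nbrCount G u A := by
  refine card_bij (fun x _ => (x : V)) ?_ ?_ ?_
  · intro x hx
    simpa [G.adj_comm] using hx
  · intro x _ y _ h
    exact Subtype.ext h
  · intro b hb
    obtain ⟨hbA, hb⟩ := mem_filter.1 hb
    exact ⟨⟨b, hbA⟩, by simpa [G.adj_comm] using hb, rfl⟩

lemma card_filter_adj_product (σ : A ≃ B) (X Z : Finset A) :
    (((X ×ˢ Z).filter (fun p => G.Adj p.1 (σ p.2))).card : ℝ) =
      ∑ v ∈ X.image (fun a : A => (a : V)),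
        (nbrCount G v (Z.image (fun a : A => (σ a : V))) : ℝ) := by
  rw [sum_image (fun x _ y _ h => Subtype.ext h), card_filter, sum_product, Nat.cast_sum]
  refine sum_congr rfl fun x _ => ?_
  rw [← card_filter, nbrCount, filter_image,
    card_image_of_injective _ (fun x y h => σ.injective (Subtype.ext h))]

lemma IsSuperRegular3.manySwitches (hG : IsSuperRegular3 G A B d ε (d - ε)) (hd : 0 < d)
    (hε : ε ≤ d / 4) (hAB : A.card = B.card) (hn : 64 ≤ d ^ 3 * A.card) :
    ManySwitches (crossAdj G A B) (d ^ 3 / 64) (d / 4) := by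
  obtain ⟨⟨-, hreg⟩, hA, hB⟩ := hG
  intro σ u F huF hF
  rw [Fintype.card_coe] at hF ⊢
  rw [← hAB] at hA hreg
  set n : ℝ := ((A.card : ℕ) : ℝ) with hndef
  have hn0 : 0 < n := by
    by_contra h
    have : n = 0 := le_antisymm (not_lt.1 h) (Nat.cast_nonneg _)
    rw [this] at hn; norm_num at hn
  set X : Finset A := (univ.filter (fun x : A => G.Adj u (σ x))) \ F with hX
  set Z : Finset A := (univ.filter (fun x : A => G.Adj x (σ u))) \ F with hZ
  have hdeg : 3 * d / 4 * n ≤ (d - ε) * n := mul_le_mul_of_nonneg_right (by linarith) hn0.le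
  have hXcard : d / 2 * n ≤ X.card := by
    have h1 : ((univ.filter (fun x : A => G.Adj u (σ x))).card : ℝ) ≤ F.card + X.card := by
      rw [hX, ← Nat.cast_add, Nat.cast_le, add_comm]
      exact card_le_card_sdiff_add_card
    rw [card_filter_adj_apply] at h1
    have := hA u u.2
    linarith
  have hZcard : d / 2 * n ≤ Z.card := by
    have h1 : ((univ.filter (fun x : A => G.Adj x (σ u))).card : ℝ) ≤ F.card + Z.card := by
      rw [hZ, ← Nat.cast_add, Nat.cast_le, add_comm]
      exact card_le_card_sdiff_add_card
    rw [card_filter_adj] at h1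
    have := hB (σ u) (σ u).2
    linarith
  have hX' : (X.image (fun a : A => (a : V))).card = X.card :=
    card_image_of_injective _ Subtype.val_injective
  have hZ' : (Z.image (fun a : A => (σ a : V))).card = Z.card :=
    card_image_of_injective _ (fun x y h => σ.injective (Subtype.ext h))
  have hεn : ε * n ≤ d / 2 * n := mul_le_mul_of_nonneg_right (by linarith) hn0.le
  have hdens := hreg (X.image (fun a : A => (a : V)))
    (image_subset_iff.2 fun a _ => a.2) (Z.image (fun a : A => (σ a : V)))
    (image_subset_iff.2 fun a _ => (σ a).2) (by rw [hX']; linarith) (by rw [hZ']; linarith)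
  have hdn : 0 < d / 2 * n := by positivity
  have hXpos : (0 : ℝ) < X.card := hdn.trans_le hXcard
  have hZpos : (0 : ℝ) < Z.card := hdn.trans_le hZcard
  rw [pairDensity, ← card_filter_adj_product, hX', hZ'] at hdens
  have hedges := (abs_le.1 hdens).1
  set E := (X ×ˢ Z).filter (fun p => G.Adj p.1 (σ p.2)) with hE
  have h1 : 3 * d / 4 ≤ (E.card : ℝ) / (X.card * Z.card) := by linarith
  rw [le_div_iff₀ (by positivity)] at h1
  have h2 : (d / 2 * n) * (d / 2 * n) ≤ (X.card : ℝ) * Z.card :=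
    mul_le_mul hXcard hZcard hdn.le hXpos.le
  have h3 : 3 * d / 4 * ((d / 2 * n) * (d / 2 * n)) ≤ E.card :=
    (mul_le_mul_of_nonneg_left h2 (by positivity)).trans h1
  have hsub : E ⊆ switchPairs (crossAdj G A B) σ u F ∪ univ.image (fun a : A => (a, a)) := by
    rintro ⟨x, z⟩ hp
    simp only [hE, hX, hZ, mem_filter, mem_product, mem_sdiff, mem_univ, true_and] at hp
    rw [mem_union, mem_image, switchPairs, mem_filter]
    by_cases hxz : x = z
    · exact Or.inr ⟨x, mem_univ x, by rw [hxz]⟩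
    · exact Or.inl ⟨mem_univ _, hp.1.1.2, hp.1.2.2, hxz, hp.1.1.1, hp.2, hp.1.2.1⟩
  have h4 : (E.card : ℝ) ≤ (switchPairs (crossAdj G A B) σ u F).card + n := by
    have h5 : (univ.image (fun a : A => (a, a))).card ≤ A.card := by
      simpa using card_image_le (s := (univ : Finset A)) (f := fun a : A => (a, a))
    have h6 := (card_le_card hsub).trans ((card_union_le _ _).trans (Nat.add_le_add_left h5 _))
    rw [hndef]
    exact_mod_cast h6
  nlinarith [mul_le_mul_of_nonneg_right hn hn0.le, pow_pos hd 3]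

lemma mem_matchingEdges_iff (hAB : Disjoint A B) (σ : A ≃ B) (a : A) (b : B) :
    s((a : V), (b : V)) ∈ matchingEdges σ ↔ σ a = b := by
  simp only [matchingEdges, mem_image, mem_univ, true_and]
  constructor
  · rintro ⟨a', h⟩
    rcases Sym2.eq_iff.1 h with ⟨h1, h2⟩ | ⟨h1, -⟩
    · rw [← Subtype.ext h1, ← Subtype.ext h2]
    · exact absurd (h1 ▸ a'.2) (disjoint_right.1 hAB b.2)
  · rintro rfl
    exact ⟨a, rfl⟩

lemma isPMEdgeSet_matchingEdges (hAB : Disjoint A B) (hU : A ∪ B = univ) {σ : A ≃ B}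
    (hσ : ∀ a, crossAdj G A B a (σ a)) : IsPMEdgeSet G (matchingEdges σ) := by
  refine ⟨fun e he => ?_, fun v => ?_⟩
  · obtain ⟨a, -, rfl⟩ := mem_image.1 (mem_coe.1 he)
    exact hσ a
  · obtain ⟨a, ha⟩ : ∃ a : A, v ∈ s((a : V), (σ a : V)) := by
      rcases mem_union.1 (hU ▸ mem_univ v) with h | h
      · exact ⟨⟨v, h⟩, by simp⟩
      · exact ⟨σ.symm ⟨v, h⟩, by simp⟩
    refine ⟨s((a : V), (σ a : V)), ⟨mem_image_of_mem _ (mem_univ a), ha⟩, ?_⟩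
    rintro e ⟨he, hve⟩
    obtain ⟨a', -, rfl⟩ := mem_image.1 he
    suffices a' = a by rw [this]
    rcases Sym2.mem_iff.1 ha with h | h <;> rcases Sym2.mem_iff.1 hve with h' | h'
    · exact Subtype.ext (h'.symm.trans h)
    · exact absurd ((h.symm.trans h') ▸ a.2) (disjoint_right.1 hAB (σ a').2)
    · exact absurd ((h'.symm.trans h) ▸ a'.2) (disjoint_right.1 hAB (σ a).2)
    · exact σ.injective (Subtype.ext (h'.symm.trans h))

lemma exists_pairs_of_subset_matchingEdges (hAB : Disjoint A B) {S : Finset (Sym2 V)}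
    {σ₀ : A ≃ B} (hS : S ⊆ matchingEdges σ₀) :
    ∃ P : Finset (A × B), P.card = S.card ∧
      ∀ σ : A ≃ B, S ⊆ matchingEdges σ → ∀ p ∈ P, σ p.1 = p.2 := by
  refine ⟨univ.filter (fun p : A × B => s((p.1 : V), (p.2 : V)) ∈ S), ?_, ?_⟩
  · refine card_bij (fun p _ => s((p.1 : V), (p.2 : V))) ?_ ?_ ?_
    · intro p hp
      exact (mem_filter.1 hp).2
    · rintro ⟨a, b⟩ - ⟨a', b'⟩ - h
      rcases Sym2.eq_iff.1 h with ⟨h1, h2⟩ | ⟨h1, -⟩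
      · exact Prod.ext (Subtype.ext h1) (Subtype.ext h2)
      · exact absurd (h1 ▸ a.2) (disjoint_right.1 hAB b'.2)
    · intro e he
      obtain ⟨a, -, rfl⟩ := mem_image.1 (hS he)
      exact ⟨(a, σ₀ a), mem_filter.2 ⟨mem_univ _, he⟩, rfl⟩
  · intro σ hσ p hp
    exact (mem_matchingEdges_iff hAB σ p.1 p.2).1 (hσ (mem_filter.1 hp).2)

/-- The distribution of the matching given by a uniformly random bijection of `N` is spread. -/
lemma isSpreadDist_of_card_le (hAB : Disjoint A B) (hU : A ∪ B = univ) {q : ℝ} (hq : 0 ≤ q)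
    (hpos : 0 < (extendingMatchings (crossAdj G A B) ∅).card)
    (hspread : ∀ P : Finset (A × B), ((extendingMatchings (crossAdj G A B) P).card : ℝ) ≤
      q ^ P.card * (extendingMatchings (crossAdj G A B) ∅).card) :
    IsSpreadDist q (fun M => IsPMEdgeSet G M) (fun M =>
      (((extendingMatchings (crossAdj G A B) ∅).filter
        (fun σ => matchingEdges σ = M)).card : ℝ) /
      (extendingMatchings (crossAdj G A B) ∅).card) := by
  set N := extendingMatchings (crossAdj G A B) ∅ with hN
  have hpos' : (0 : ℝ) < N.card := by exact_mod_cast hpos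
  have hsum : ∀ p : Finset (Sym2 V) → Prop, ∀ [DecidablePred p],
      ∑ M ∈ univ.filter p, ((N.filter (fun σ => matchingEdges σ = M)).card : ℝ) / N.card =
        ((N.filter (fun σ => p (matchingEdges σ))).card : ℝ) / N.card := by
    intro p _
    rw [← sum_div, ← Nat.cast_sum, card_eq_sum_card_fiberwise
      (s := N.filter (fun σ => p (matchingEdges σ))) (t := univ.filter p) (f := matchingEdges)
      (fun σ hσ => by simpa using (mem_filter.1 (mem_coe.1 hσ)).2)]
    congr 2
    refine sum_congr rfl fun M hM => ?_
    rw [filter_filter]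
    congr 1
    refine filter_congr fun σ _ => ⟨fun h => ⟨?_, h⟩, fun h => h.2⟩
    rw [h]; exact (mem_filter.1 hM).2
  refine ⟨fun M => by positivity, ?_, fun M hM => ?_, fun S => ?_⟩
  · have := hsum (fun _ => True)
    simpa [hpos'.ne'] using this
  · have : (N.filter (fun σ => matchingEdges σ = M)).Nonempty := by
      rw [nonempty_iff_ne_empty]
      rintro h
      simp [h] at hM
    obtain ⟨σ, hσ⟩ := this
    obtain ⟨hσN, rfl⟩ := mem_filter.1 hσ
    exact isPMEdgeSet_matchingEdges hAB hU (mem_filter.1 hσN).2.1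
  · rw [hsum (fun M => S ⊆ M), div_le_iff₀ hpos']
    rcases (N.filter (fun σ => S ⊆ matchingEdges σ)).eq_empty_or_nonempty with h | ⟨σ₀, hσ₀⟩
    · rw [h, card_empty, Nat.cast_zero]
      positivity
    · obtain ⟨P, hPS, hP⟩ := exists_pairs_of_subset_matchingEdges hAB (mem_filter.1 hσ₀).2
      rw [← hPS]
      refine le_trans (Nat.cast_le.2 (card_le_card fun σ hσ => ?_)) (hspread P)
      obtain ⟨hσN, hσS⟩ := mem_filter.1 hσ
      exact mem_filter.2 ⟨mem_univ σ, (mem_filter.1 hσN).2.1, hP σ hσS⟩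

end Graph

/-- Spread perfect matchings in super-regular bipartite graphs: for every `d > 0` there are
`δ₀ > 0`, `C > 0` and `n₀` such that every `(d,δ)`-super-regular bipartite graph
(`0 < δ ≤ δ₀`) with parts of size `n ≥ n₀` carries a `(C/n)`-spread distribution on its
perfect matchings (ground set: the edge set of `G`). -/
theorem statement12 :
    ∀ d : ℝ, 0 < d →
    ∃ δ₀ : ℝ, 0 < δ₀ ∧ ∃ C : ℝ, 0 < C ∧ ∃ n₀ : ℕ,
    ∀ δ : ℝ, 0 < δ → δ ≤ δ₀ → ∀ n : ℕ, n₀ ≤ n →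
    ∀ (V : Type) (_ : Fintype V) (_ : DecidableEq V)
      (G : SimpleGraph V) (_ : DecidableRel G.Adj) (A B : Finset V),
    Disjoint A B → A ∪ B = Finset.univ → A.card = n → B.card = n →
    (∀ u v, G.Adj u v → (u ∈ A ∧ v ∈ B) ∨ (u ∈ B ∧ v ∈ A)) →
    IsSuperRegular G A B d δ →
    ∃ μ : Finset (Sym2 V) → ℝ,
      IsSpreadDist (C / (n : ℝ)) (fun M => IsPMEdgeSet G M) μ := by
  intro d hd
  obtain ⟨m, hm⟩ := exists_nat_ge (4 / d)
  obtain ⟨n₀, hn₀⟩ := exists_nat_ge (64 / d ^ 3 + 4 / d)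
  have hd3 : 0 < d ^ 3 := by positivity
  refine ⟨d / 4, by positivity, ((1 + 1 / (d ^ 3 / 64)) * Real.exp 2) ^ m, by positivity, n₀, ?_⟩
  intro δ _ hδ n hn V _ _ G _ A B hdisj hU hA hB _ hG
  have hnn : 64 / d ^ 3 + 4 / d ≤ (n : ℝ) := hn₀.trans (Nat.cast_le.2 hn)
  have h1 : 64 / d ^ 3 ≤ (n : ℝ) := (le_add_of_nonneg_right (by positivity)).trans hnn
  have h2 : 4 / d ≤ (n : ℝ) := (le_add_of_nonneg_left (by positivity)).trans hnn
  rw [div_le_iff₀ hd] at hm h2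
  rw [div_le_iff₀ hd3] at h1
  have hm1 : 1 ≤ m := by
    by_contra h
    have : m = 0 := by omega
    rw [this] at hm
    norm_num at hm
  have hR : ManySwitches (crossAdj G A B) (d ^ 3 / 64) (d / 4) :=
    hG.manySwitches hd hδ (hA.trans hB.symm) (by rw [hA]; linarith)
  have hγ : 1 ≤ d / 4 * (Fintype.card A : ℝ) := by
    rw [Fintype.card_coe, hA]; linarith
  have hcard : Fintype.card A = Fintype.card B := by
    rw [Fintype.card_coe, Fintype.card_coe, hA, hB]
  refine ⟨_, isSpreadDist_of_card_le hdisj hU (by positivity)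
    (card_matchings_pos hR (by positivity) hγ hcard) fun P => ?_⟩
  have h := card_extendingMatchings_le hR (by positivity) hγ hcard (m := m) (by linarith) hm1 P
  rwa [Fintype.card_coe, hA] at h
end
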